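/- arXiv:math/9909018 — 4 statements merged into one kernel-verified Lean document; each statement's English description precedes it below -/
import Mathlib

section
/- Let F ∈ K[x_1,…,x_n] be homogeneous of degree δ and let a be a singular point of the hypersurface F = 0 in P^{n−1} lying in the chart x_n ≠ 0, which is a weighted homogeneous isolated singularity of total degree d with p = char K not dividing d. Then there exist homogeneous polynomials Q, R_1,…,R_{n−1} ∈ K[x_1,…,x_n] such that Q·F = Σ_{j=1}^{n−1} R_j ∂F/∂x_j, Q(a) ≠ 0, and R_j(a) = 0 for j = 1,…,n−1. -/
open MvPolynomial

noncomputable section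

/-- A polynomial differential `m`-form over `K[x_1,…,x_n]`, recorded by its coefficients:
to each subset `T ⊆ {1,…,n}` of cardinality `m` (the index set `i_1 < ⋯ < i_m` of
`dx_{i_1} ∧ ⋯ ∧ dx_{i_m}`) we assign a polynomial coefficient. -/
abbrev MForm (K : Type*) [CommSemiring K] (n m : ℕ) : Type _ :=
  ∀ T : Finset (Fin n), T.card = m → MvPolynomial (Fin n) K

/-- The wedge product `dg ∧ ω` of the exterior derivative of `g` with an `m`-form `ω`:
its coefficient on `T = {i_0 < ⋯ < i_m}` is `∑ k, (-1)^k (∂g/∂x_{i_k}) ω(T \ {i_k})`. -/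
def wedgeD {K : Type*} [CommRing K] {n m : ℕ} (g : MvPolynomial (Fin n) K)
    (ω : MForm K n m) : MForm K n (m + 1) := fun T hT =>
  ∑ j ∈ T.attach,
    (-1 : MvPolynomial (Fin n) K) ^ (T.filter (fun i => i < j.1)).card *
      pderiv j.1 g * ω (T.erase j.1) (by rw [Finset.card_erase_of_mem j.2]; omega)

/-- `g` is homogeneous of (possibly negative) degree `d : ℤ`; by convention the only
homogeneous polynomial of negative degree is `0`. -/
def HomogZ {K : Type*} [CommSemiring K] {σ : Type*} (g : MvPolynomial σ K) (d : ℤ) : Prop :=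
  g = 0 ∨ ∃ d' : ℕ, (d' : ℤ) = d ∧ g.IsHomogeneous d'

/-- A list of ring elements is a regular sequence when each entry is a nonzerodivisor
modulo the ideal generated by the preceding entries. -/
def IsRegSeq {R : Type*} [CommRing R] (rs : List R) : Prop :=
  ∀ (i : ℕ) (hi : i < rs.length) (x : R),
    rs[i] * x ∈ Ideal.span {y | ∃ (j : ℕ) (hj : j < i), y = rs[j]'(hj.trans hi)} →
    x ∈ Ideal.span {y | ∃ (j : ℕ) (hj : j < i), y = rs[j]'(hj.trans hi)}

/-- The origin is an isolated critical point of (the polynomial map defined by) `h`: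
it is a common zero of all partial derivatives `∂h/∂x_i`, and there is a Zariski-open
neighborhood `U` of the origin (wlog a basic open set `u ≠ 0` with `u(0) ≠ 0`) on which
the origin is the only common zero of the `∂h/∂x_i`. -/
def IsIsolatedCriticalAtZero {K : Type*} [CommSemiring K] {σ : Type*}
    (h : MvPolynomial σ K) : Prop :=
  (∀ i, eval (0 : σ → K) (pderiv i h) = 0) ∧
  ∃ u : MvPolynomial σ K, eval (0 : σ → K) u ≠ 0 ∧
    ∀ y : σ → K, eval y u ≠ 0 → (∀ i, eval y (pderiv i h) = 0) → y = 0

/-- The dehomogenization of `F` in the affine chart `x_j = 1` of `ℙ^{n-1}`, centered at the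
point `a` (which should satisfy `a j = 1`): a polynomial in the `n-1` variables `i ≠ j`. -/
def chartPoly {K : Type*} [CommRing K] {n : ℕ} (F : MvPolynomial (Fin n) K) (j : Fin n)
    (a : Fin n → K) : MvPolynomial {i : Fin n // i ≠ j} K :=
  aeval (fun i : Fin n => if h : i = j then 1 else X ⟨i, h⟩ + C (a i)) F

/-- `g` is weighted homogeneous of total degree `d`: there are positive integer weights
`α_i` with gcd `1` such that every monomial of `g` has weighted degree `d`
(equivalently, `g(λ^{α_1}x_1,…) = λ^d g(x)`). -/
def IsWeightedHomogTD {K : Type*} [CommSemiring K] {σ : Type*} [Fintype σ]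
    (g : MvPolynomial σ K) (d : ℕ) : Prop :=
  ∃ α : σ → ℕ, (∀ i, 0 < α i) ∧ Finset.univ.gcd α = 1 ∧ IsWeightedHomogeneous α g d

/-- The hypersurface `h = 0` has a weighted homogeneous singularity at the origin, of total
degree `d`: the complete local ring `K[[x]]/(h)` is isomorphic as a `K`-algebra to
`K[[x]]/(g)` for some weighted homogeneous `g` of total degree `d`. -/
def WeightedHomogSing {K : Type*} [Field K] {σ : Type*} [Fintype σ]
    (h : MvPolynomial σ K) (d : ℕ) : Prop :=
  ∃ g : MvPolynomial σ K, IsWeightedHomogTD g d ∧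
    Nonempty ((MvPowerSeries σ K ⧸ Ideal.span {(h : MvPowerSeries σ K)}) ≃ₐ[K]
      MvPowerSeries σ K ⧸ Ideal.span {(g : MvPowerSeries σ K)})

/-- The common zero locus, in the projective space `ℙ^{n-1}`, of a set `S` of
(homogeneous) polynomials. -/
def projZeros {K : Type*} [Field K] {n : ℕ} (S : Set (MvPolynomial (Fin n) K)) :
    Set (Projectivization K (Fin n → K)) :=
  {x | ∃ (v : Fin n → K) (hv : v ≠ 0), Projectivization.mk K v hv = x ∧ ∀ g ∈ S, eval v g = 0}

/-- A homogeneous polynomial `G` in `m` variables defines a smooth hypersurface in `ℙ^{m-1}`: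
`G` and its partial derivatives have no common zero in `ℙ^{m-1}`. -/
def SmoothProj {K : Type*} [Field K] {σ : Type*} (G : MvPolynomial σ K) : Prop :=
  ∀ y : σ → K, y ≠ 0 → ¬ (eval y G = 0 ∧ ∀ i, eval y (pderiv i G) = 0)

/-- `F(x_1,…,x_{n-1},0)`, as a polynomial in the first `n-1` variables. -/
def truncAtLast {K : Type*} [CommRing K] {n : ℕ} (F : MvPolynomial (Fin n) K) :
    MvPolynomial (Fin (n - 1)) K :=
  aeval (fun i : Fin n => if h : (i : ℕ) < n - 1 then X (⟨i, h⟩ : Fin (n - 1)) else 0) F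

/-- `F(y_1,…,y_{n-1},1)`, as a polynomial in the first `n-1` variables. -/
def dehomAtLast {K : Type*} [CommRing K] {n : ℕ} (F : MvPolynomial (Fin n) K) :
    MvPolynomial (Fin (n - 1)) K :=
  aeval (fun i : Fin n => if h : (i : ℕ) < n - 1 then X (⟨i, h⟩ : Fin (n - 1)) else 1) F

/-- The point `(b, 1) ∈ K^n` lying over `b ∈ K^{n-1}` (affine chart `x_n = 1`). -/
def liftPt {K : Type*} [CommRing K] {n : ℕ} (b : Fin (n - 1) → K) : Fin n → K :=
  fun i => if h : (i : ℕ) < n - 1 then b ⟨i, h⟩ else 1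

/-- Context of the paper: `f` has degree `δ ≥ 2`, `1 ≤ δ' ≤ δ - 1`, and
`f = f^(δ) + f^(δ') + (terms of degree < δ')`, with `f^(δ')` the (nonzero) homogeneous
component of second-highest degree. -/
def Setup {K : Type*} [Field K] {n : ℕ} (δ δ' : ℕ) (f : MvPolynomial (Fin n) K) : Prop :=
  f.totalDegree = δ ∧ 2 ≤ δ ∧ 1 ≤ δ' ∧ δ' < δ ∧
  (∀ j, δ' < j → j < δ → homogeneousComponent j f = 0) ∧
  homogeneousComponent δ' f ≠ 0

/-- Hypothesis (A): `p ∤ δ`, `p ∤ δ'`; every singular point of the hypersurface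
`f^(δ) = 0` in `ℙ^{n-1}` (taken with a representative normalized by `a j = 1`) is an
isolated singularity, weighted homogeneous of some total degree `d` with `p ∤ d`,
and does not lie on the hypersurface `f^(δ') = 0`. -/
def HypA {K : Type*} [Field K] {n : ℕ} (p δ δ' : ℕ) (f : MvPolynomial (Fin n) K) : Prop :=
  ¬ (p ∣ δ) ∧ ¬ (p ∣ δ') ∧
  ∀ (a : Fin n → K) (j : Fin n), a j = 1 →
    eval a (homogeneousComponent δ f) = 0 →
    (∀ i, eval a (pderiv i (homogeneousComponent δ f)) = 0) →
    IsIsolatedCriticalAtZero (chartPoly (homogeneousComponent δ f) j a) ∧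
    (∃ d : ℕ, ¬ (p ∣ d) ∧ WeightedHomogSing (chartPoly (homogeneousComponent δ f) j a) d) ∧
    eval a (homogeneousComponent δ' f) ≠ 0

/-- Hypothesis (B): `p ∣ δ`, `p ∤ δ'`, the common zero locus of the `∂f^(δ)/∂x_i` in
`ℙ^{n-1}` is finite and nonempty, and none of its points lies on the hypersurface
`f^(δ') = 0`. -/
def HypB {K : Type*} [Field K] {n : ℕ} (p δ δ' : ℕ) (f : MvPolynomial (Fin n) K) : Prop :=
  (p ∣ δ) ∧ ¬ (p ∣ δ') ∧
  (projZeros {g | ∃ i, g = pderiv i (homogeneousComponent δ f)}).Finite ∧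
  (projZeros {g | ∃ i, g = pderiv i (homogeneousComponent δ f)}).Nonempty ∧
  ∀ a : Fin n → K, a ≠ 0 → (∀ i, eval a (pderiv i (homogeneousComponent δ f)) = 0) →
    eval a (homogeneousComponent δ' f) ≠ 0

/-- The localization of the polynomial ring at the maximal ideal of the point `b`. -/
instance evalKerPrime (K : Type*) [Field K] (σ : Type*) (b : σ → K) :
    (RingHom.ker (eval b : MvPolynomial σ K →+* K)).IsPrime := RingHom.ker_isPrime _

/-- The local ring of affine space at the point `b`, i.e. the localization of the
polynomial ring at the maximal ideal of polynomials vanishing at `b`. -/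
abbrev LocAt (K : Type*) [Field K] {σ : Type*} (b : σ → K) :=
  Localization.AtPrime (RingHom.ker (eval b : MvPolynomial σ K →+* K))

/-- The Milnor number of `h` at the point `b`: the `K`-dimension of the quotient of the
local ring at `b` by the ideal generated by the partial derivatives of `h`. -/
def milnorAt {K : Type*} [Field K] {σ : Type*} (b : σ → K) (h : MvPolynomial σ K) : ℕ :=
  Module.finrank K
    ((LocAt K b) ⧸ Ideal.span (Set.range fun i =>
      algebraMap (MvPolynomial σ K) (LocAt K b) (pderiv i h)))

lemma aux_mem_m {K : Type*} [Field K] {σ : Type*} (f : MvPolynomial σ K) :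
    f ∈ idealOfVars σ K ↔ constantCoeff f = 0 := by
  have := mem_pow_idealOfVars_iff' 1 f
  rw [pow_one] at this
  rw [this]
  constructor
  · intro h; exact h 0 (by simp)
  · intro h x hx
    have : x = 0 := by
      have : Finsupp.degree x = 0 := by omega
      exact (Finsupp.degree_eq_zero_iff x).1 this
    subst this; exact h

lemma aux_chain {K : Type*} [Field K] {σ τ : Type*} [Fintype σ]
    (D : Derivation K (MvPolynomial τ K) (MvPolynomial τ K))
    (φ : MvPolynomial σ K →ₐ[K] MvPolynomial τ K) (f : MvPolynomial σ K) :
    D (φ f) = ∑ j, φ (pderiv j f) * D (φ (X j)) := by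
  classical
  induction f using MvPolynomial.induction_on with
  | C a =>
    have : φ (C a) = C a := by simpa [algebraMap_eq] using φ.commutes a
    simp [this]
  | add p q hp hq => simp [hp, hq, add_mul, Finset.sum_add_distrib]
  | mul_X p i hp =>
    simp only [map_mul, Derivation.leibniz, smul_eq_mul, hp, pderiv_X, map_add, add_mul,
      Finset.sum_add_distrib, Finset.mul_sum]
    congr 1
    · rw [Finset.sum_eq_single i]
      · simp
      · intro b _ hb; simp [hb.symm]
      · simp
    · exact Finset.sum_congr rfl fun j _ => by ring

lemma aux_hom_m {K : Type*} [Field K] {σ : Type*}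
    (φ : MvPolynomial σ K →ₐ[K] MvPolynomial σ K) (h : ∀ i, φ (X i) ∈ idealOfVars σ K) (N : ℕ)
    (f : MvPolynomial σ K) (hf : f ∈ idealOfVars σ K ^ N) : φ f ∈ idealOfVars σ K ^ N := by
  have h1 : Ideal.map φ (idealOfVars σ K) ≤ idealOfVars σ K := by
    rw [idealOfVars, Ideal.map_span, Ideal.span_le]
    rintro _ ⟨_, ⟨i, rfl⟩, rfl⟩
    exact h i
  have h2 : Ideal.map φ (idealOfVars σ K ^ N) ≤ idealOfVars σ K ^ N := by
    rw [Ideal.map_pow]; exact Ideal.pow_right_mono h1 N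
  exact h2 (Ideal.mem_map_of_mem φ hf)

lemma aux_der_m {K : Type*} [Field K] {σ : Type*} [Fintype σ]
    (E : Derivation K (MvPolynomial σ K) (MvPolynomial σ K))
    (h : ∀ i, E (X i) ∈ idealOfVars σ K) (f : MvPolynomial σ K) : E f ∈ idealOfVars σ K := by
  have := aux_chain E (AlgHom.id K _) f
  simp only [AlgHom.id_apply] at this
  rw [this]
  exact Ideal.sum_mem _ fun j _ => Ideal.mul_mem_left _ _ (h j)

lemma aux_der_pow {K : Type*} [Field K] {σ : Type*} [Fintype σ]
    (E : Derivation K (MvPolynomial σ K) (MvPolynomial σ K))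
    (h : ∀ i, E (X i) ∈ idealOfVars σ K) (N : ℕ) (f : MvPolynomial σ K)
    (hf : f ∈ idealOfVars σ K ^ N) : E f ∈ idealOfVars σ K ^ N := by
  induction N generalizing f with
  | zero => simp
  | succ N ih =>
    rw [pow_succ] at hf ⊢
    refine Submodule.mul_induction_on hf ?_ ?_
    · intro a ha b hb
      rw [Derivation.leibniz, smul_eq_mul, smul_eq_mul]
      refine Ideal.add_mem _ (Ideal.mul_mem_mul ha (aux_der_m E h b)) ?_
      exact Ideal.mul_mem_mul_rev (ih a ha) hb
    · intro x y hx hy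
      rw [map_add]; exact Ideal.add_mem _ hx hy

lemma aux_core {K : Type*} [Field K] {σ : Type*} [Fintype σ] (h g : MvPolynomial σ K) (N : ℕ)
    (φ ψ : MvPolynomial σ K →ₐ[K] MvPolynomial σ K)
    (hφ : ∀ i, φ (X i) ∈ idealOfVars σ K) (hψ : ∀ i, ψ (X i) ∈ idealOfVars σ K)
    (hφh : φ h ∈ Ideal.span {g} ⊔ idealOfVars σ K ^ N)
    (hψg : ψ g ∈ Ideal.span {h} ⊔ idealOfVars σ K ^ N)
    (hθ : ∀ f, ψ (φ f) - f ∈ Ideal.span {h} ⊔ idealOfVars σ K ^ N)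
    (hh : h ∈ idealOfVars σ K * idealOfVars σ K)
    (E : Derivation K (MvPolynomial σ K) (MvPolynomial σ K))
    (hE : ∀ i, E (X i) ∈ idealOfVars σ K) (d : K) (hd : d ≠ 0) (hEg : E g = C d * g) :
    h ∈ idealOfVars σ K * Ideal.span (Set.range fun j => pderiv j h) ⊔
      idealOfVars σ K * Ideal.span {h} ⊔ idealOfVars σ K ^ N := by
  set m := idealOfVars σ K with hm
  set J := Ideal.span (Set.range fun j => pderiv j h) with hJ
  set L := m * J ⊔ m * Ideal.span {h} ⊔ m ^ N with hL
  have hφm : ∀ f ∈ m, φ f ∈ m := fun f hf => by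
    simpa using aux_hom_m φ hφ 1 f (by simpa using hf)
  have hψm : ∀ f ∈ m, ψ f ∈ m := fun f hf => by
    simpa using aux_hom_m ψ hψ 1 f (by simpa using hf)
  have hNL : m ^ N ≤ L := le_sup_right
  have hhL : m * Ideal.span {h} ≤ L := le_sup_right.trans le_sup_left
  have hJL : m * J ≤ L := le_sup_left.trans le_sup_left
  have hIL : m * (Ideal.span {h} ⊔ m ^ N) ≤ L := by
    rw [Ideal.mul_sup]
    exact sup_le hhL (Ideal.mul_le_right.trans hNL)
  have hθh : ψ (φ h) - h ∈ L := by
    apply hIL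
    generalize (Ideal.span {h} ⊔ m ^ N) = I at hθ
    refine Submodule.mul_induction_on hh ?_ ?_
    · intro a ha b hb
      have : ψ (φ (a * b)) - a * b = ψ (φ a) * (ψ (φ b) - b) + b * (ψ (φ a) - a) := by
        simp only [map_mul]; ring
      rw [this]
      exact Ideal.add_mem _ (Ideal.mul_mem_mul (hψm _ (hφm _ ha)) (hθ b))
        (Ideal.mul_mem_mul hb (hθ a))
    · intro x y hx hy
      have : ψ (φ (x + y)) - (x + y) = (ψ (φ x) - x) + (ψ (φ y) - y) := by
        simp only [map_add]; ring
      rw [this]; exact Ideal.add_mem _ hx hy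
  obtain ⟨wg, hwg, ε, hε, hφe⟩ := Submodule.mem_sup.1 hφh
  obtain ⟨w, rfl⟩ := Ideal.mem_span_singleton'.1 hwg
  by_cases hw : w ∈ m
  · have h1 : ψ (φ h) ∈ L := by
      rw [← hφe, map_add, map_mul]
      refine Ideal.add_mem _ (hIL (Ideal.mul_mem_mul (hψm _ hw) hψg)) (hNL (aux_hom_m ψ hψ N _ hε))
    simpa using Ideal.sub_mem _ h1 hθh
  · have hc : constantCoeff w ≠ 0 := fun hc => hw ((aux_mem_m w).2 hc)
    set v := C d * w + E w with hv
    have hEe : E ε ∈ m ^ N := aux_der_pow E hE N ε hε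
    have key : w * E (φ h) - v * φ h ∈ m ^ N := by
      have : w * E (φ h) - v * φ h = w * E ε - v * ε := by
        rw [← hφe, map_add, Derivation.leibniz, hEg, smul_eq_mul, smul_eq_mul, hv]; ring
      rw [this]
      exact Ideal.sub_mem _ (Ideal.mul_mem_left _ _ hEe) (Ideal.mul_mem_left _ _ hε)
    have key2 := hNL (aux_hom_m ψ hψ N _ key)
    rw [map_sub, map_mul, map_mul] at key2
    have h3 : ψ (E (φ h)) ∈ L := by
      rw [aux_chain E φ h, map_sum]
      refine Ideal.sum_mem _ fun j _ => ?_
      rw [map_mul, mul_comm]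
      have hj : ψ (E (φ (X j))) ∈ m := hψm _ (aux_der_m E hE _)
      have : ψ (E (φ (X j))) * ψ (φ (pderiv j h)) = ψ (E (φ (X j))) * pderiv j h +
        ψ (E (φ (X j))) * (ψ (φ (pderiv j h)) - pderiv j h) := by ring
      rw [this]
      exact Ideal.add_mem _ (hJL (Ideal.mul_mem_mul hj (Ideal.subset_span ⟨j, rfl⟩)))
        (hIL (Ideal.mul_mem_mul hj (hθ _)))
    have h4 : ψ v * ψ (φ h) ∈ L := by
      have := Ideal.sub_mem _ (Ideal.mul_mem_left L (ψ w) h3) key2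
      simpa using this
    have h5 : ψ v * h ∈ L := by
      have := Ideal.sub_mem _ h4 (Ideal.mul_mem_left L (ψ v) hθh)
      convert this using 1; ring
    have hEw : constantCoeff (E w) = 0 := (aux_mem_m _).1 (aux_der_m E hE w)
    have hcv : constantCoeff v = d * constantCoeff w := by simp [hv, hEw]
    set c := d * constantCoeff w with hcdef
    have hc0 : c ≠ 0 := mul_ne_zero hd hc
    have h6 : ψ v - C c ∈ m := by
      have : v - C c ∈ m := (aux_mem_m _).2 (by simp [hcv])
      have h7 := hψm _ this
      have : ψ (C c) = C c := by simpa [algebraMap_eq] using ψ.commutes c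
      rwa [map_sub, this] at h7
    have h8 : C c * h ∈ L := by
      have := Ideal.sub_mem _ h5 (hhL (Ideal.mul_mem_mul h6 (Ideal.mem_span_singleton_self h)))
      convert this using 1; ring
    have h9 := Ideal.mul_mem_left L (C c⁻¹) h8
    rwa [← mul_assoc, ← C_mul, inv_mul_cancel₀ hc0, C_1, one_mul] at h9

lemma aux_krull {K : Type*} [Field K] {σ : Type*} [Fintype σ] (h : MvPolynomial σ K)
    (H : ∀ N, h ∈ idealOfVars σ K * Ideal.span (Set.range fun j => pderiv j h) ⊔
      idealOfVars σ K * Ideal.span {h} ⊔ idealOfVars σ K ^ N) :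
    ∃ (u : MvPolynomial σ K) (r : σ → MvPolynomial σ K), constantCoeff u ≠ 0 ∧
      (∀ j, constantCoeff (r j) = 0) ∧ u * h = ∑ j, r j * pderiv j h := by
  set m := idealOfVars σ K with hm
  set J := Ideal.span (Set.range fun j => pderiv j h) with hJ
  set L := m * J ⊔ m * Ideal.span {h} with hL
  have h1 : (Ideal.Quotient.mk L h) ∈ (⨅ i : ℕ, m ^ i • ⊤ :
      Submodule (MvPolynomial σ K) (MvPolynomial σ K ⧸ L)) := by
    rw [Submodule.mem_iInf]
    intro N
    obtain ⟨x, hx, y, hy, hxy⟩ := Submodule.mem_sup.1 (H N)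
    have : Ideal.Quotient.mk L h = y • (1 : MvPolynomial σ K ⧸ L) := by
      rw [← hxy, map_add, Ideal.Quotient.eq_zero_iff_mem.2 hx, zero_add, Algebra.smul_def, mul_one]
      rfl
    rw [this]
    exact Submodule.smul_mem_smul hy trivial
  obtain ⟨⟨r, hr⟩, hr2⟩ := (Ideal.mem_iInf_smul_pow_eq_bot_iff m _).1 h1
  have h2 : h - r * h ∈ L := by
    rw [← Ideal.Quotient.eq]
    rw [← hr2, Algebra.smul_def]
    simp only [map_mul]
    rfl
  obtain ⟨x, hx, y, hy, hxy⟩ := Submodule.mem_sup.1 h2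
  rw [mul_comm] at hy
  obtain ⟨s, hs, rfl⟩ := Ideal.mem_span_singleton_mul.1 hy
  have hx' : x ∈ m • Submodule.span (MvPolynomial σ K) (Set.range fun j => pderiv j h) := hx
  rw [Submodule.mem_ideal_smul_span_iff_exists_sum] at hx'
  obtain ⟨a, ha, hax⟩ := hx'
  refine ⟨1 - r - s, fun j => a j, ?_, fun j => (aux_mem_m _).1 (ha j), ?_⟩
  · simp [(aux_mem_m _).1 hr, (aux_mem_m _).1 hs]
  · rw [Finsupp.sum_fintype _ _ (by simp)] at hax
    simp only [smul_eq_mul] at hax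
    rw [hax]
    linear_combination -hxy


lemma aux_chi {K : Type*} [Field K] {σ : Type*} (χ : MvPowerSeries σ K →ₐ[K] K)
    (f : MvPowerSeries σ K) : χ f = MvPowerSeries.constantCoeff f := by
  by_contra hne
  have hu : IsUnit (f - algebraMap K _ (χ f)) := by
    rw [MvPowerSeries.isUnit_iff_constantCoeff, isUnit_iff_ne_zero]
    intro h0
    apply hne
    rw [map_sub, sub_eq_zero] at h0
    rw [h0]
    simp [MvPowerSeries.algebraMap_apply]
  have := hu.map χ
  simp at this

/-- The map `K[[x]]/(g) → K[x]/((g) + m^N)`. -/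
def auxTr {K : Type*} [Field K] {σ : Type*} [Fintype σ] (g : MvPolynomial σ K) (N : ℕ) :
    (MvPowerSeries σ K ⧸ Ideal.span {(g : MvPowerSeries σ K)}) →ₐ[K]
      MvPolynomial σ K ⧸ (Ideal.span {g} ⊔ idealOfVars σ K ^ N) :=
  Ideal.Quotient.liftₐ _ ((Ideal.Quotient.factorₐ K
      (le_sup_right : idealOfVars σ K ^ N ≤ Ideal.span {g} ⊔ idealOfVars σ K ^ N)).comp
      ((MvPowerSeries.truncTotalAlgHom σ K N).restrictScalars K)) (by
    intro a ha
    obtain ⟨b, rfl⟩ := Ideal.mem_span_singleton'.1 ha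
    have h1 : MvPowerSeries.truncTotalAlgHom σ K N (g : MvPowerSeries σ K) =
        Ideal.Quotient.mk _ g := (MvPowerSeries.truncTotalAlgHom σ K N).commutes g
    have h2 : (Ideal.Quotient.factorₐ K
      (le_sup_right : idealOfVars σ K ^ N ≤ Ideal.span {g} ⊔ idealOfVars σ K ^ N))
      (Ideal.Quotient.mk _ g) = 0 :=
      Ideal.Quotient.eq_zero_iff_mem.2
        ((le_sup_left : Ideal.span {g} ≤ _) (Ideal.mem_span_singleton_self g))
    rw [map_mul]
    simp only [AlgHom.comp_apply, AlgHom.restrictScalars_apply]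
    rw [h1, h2, mul_zero])

lemma auxTr_mk {K : Type*} [Field K] {σ : Type*} [Fintype σ] (g : MvPolynomial σ K) (N : ℕ)
    (q : MvPowerSeries σ K) :
    auxTr g N (Ideal.Quotient.mk _ q) = Ideal.Quotient.mk _ (MvPowerSeries.truncTotal N q) := rfl

lemma auxTr_mk_coe {K : Type*} [Field K] {σ : Type*} [Fintype σ] (g : MvPolynomial σ K) (N : ℕ)
    (q : MvPolynomial σ K) :
    auxTr g N (Ideal.Quotient.mk _ (q : MvPowerSeries σ K)) = Ideal.Quotient.mk _ q := by
  rw [auxTr_mk, Ideal.Quotient.eq]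
  refine (le_sup_right : idealOfVars σ K ^ N ≤ _) ?_
  exact (MvPolynomial.mem_pow_idealOfVars_iff' ..).mpr fun x hx ↦ by
    simp [MvPowerSeries.coeff_truncTotal _ hx]

lemma aux_ker {K : Type*} [Field K] {σ : Type*} [Fintype σ] (N : ℕ) (q : MvPowerSeries σ K) :
    q - (MvPowerSeries.truncTotal N q : MvPolynomial σ K) ∈
      (idealOfVars σ K ^ N • ⊤ : Submodule (MvPolynomial σ K) (MvPowerSeries σ K)) := by
  set x := q - (MvPowerSeries.truncTotal N q : MvPolynomial σ K) with hx
  have hxt : MvPowerSeries.truncTotal N x = 0 := by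
    ext e
    by_cases he : Finsupp.degree e < N
    · rw [MvPowerSeries.coeff_truncTotal _ he, hx]
      simp [MvPowerSeries.coeff_truncTotal _ he]
    · rw [MvPowerSeries.coeff_truncTotal_eq_zero _ (by omega)]; simp
  have h1 : MvPowerSeries.toAdicCompletion σ K x ∈
      (AdicCompletion.eval (idealOfVars σ K) (MvPolynomial σ K) N).ker := by
    rw [LinearMap.mem_ker]
    change (MvPowerSeries.toAdicCompletion σ K x).val N = 0
    rw [MvPowerSeries.toAdicCompletion_apply_eq_mk_truncTotal, hxt]; rfl
  rw [← AdicCompletion.pow_smul_top_eq_ker_eval (idealOfVars_fg σ K)] at h1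
  have h2 := Submodule.mem_map_of_mem
    (f := (MvPowerSeries.toAdicCompletionAlgEquiv σ K).symm.toLinearMap) h1
  rw [Submodule.map_smul''] at h2
  have h3 : (MvPowerSeries.toAdicCompletionAlgEquiv σ K).symm
      (MvPowerSeries.toAdicCompletion σ K x) = x :=
    (MvPowerSeries.toAdicCompletionAlgEquiv σ K).symm_apply_apply x
  have h4 : (MvPowerSeries.toAdicCompletionAlgEquiv σ K).symm.toLinearMap
      (MvPowerSeries.toAdicCompletion σ K x) = x := h3
  rw [h4] at h2
  exact Submodule.smul_mono le_rfl le_top h2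

lemma aux_lift {K : Type*} [Field K] {σ : Type*} [Fintype σ] (h g : MvPolynomial σ K) (N : ℕ)
    (hN : N ≠ 0) (hg : constantCoeff g = 0)
    (e : (MvPowerSeries σ K ⧸ Ideal.span {(h : MvPowerSeries σ K)}) →ₐ[K]
      MvPowerSeries σ K ⧸ Ideal.span {(g : MvPowerSeries σ K)}) :
    ∃ φ : MvPolynomial σ K →ₐ[K] MvPolynomial σ K, (∀ i, φ (X i) ∈ idealOfVars σ K) ∧
      (∀ q : MvPolynomial σ K, auxTr g N (e (Ideal.Quotient.mk _ (q : MvPowerSeries σ K))) =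
        Ideal.Quotient.mk _ (φ q)) ∧
      (∀ q : MvPowerSeries σ K, auxTr g N (e (Ideal.Quotient.mk _ q)) =
        Ideal.Quotient.mk _ (φ (MvPowerSeries.truncTotal N q))) := by
  let Λ : MvPowerSeries σ K →ₐ[K] MvPolynomial σ K ⧸ (Ideal.span {g} ⊔ idealOfVars σ K ^ N) :=
    ((auxTr g N).comp e).comp (Ideal.Quotient.mkₐ K _)
  have hsurj : ∀ i, ∃ f : MvPolynomial σ K, Ideal.Quotient.mk _ f = Λ (MvPowerSeries.X i) :=
    fun i => Ideal.Quotient.mk_surjective _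
  choose F hF using hsurj
  let φ : MvPolynomial σ K →ₐ[K] MvPolynomial σ K := aeval F
  have hφX : ∀ i, φ (X i) = F i := fun i => aeval_X _ _
  have hle : Ideal.span {g} ⊔ idealOfVars σ K ^ N ≤ idealOfVars σ K := by
    refine sup_le ?_ (Ideal.pow_le_self hN)
    rw [Ideal.span_le, Set.singleton_subset_iff]
    exact (aux_mem_m g).2 hg
  have hφm : ∀ i, φ (X i) ∈ idealOfVars σ K := by
    intro i
    rw [hφX]
    let χ0 : MvPolynomial σ K ⧸ (Ideal.span {g} ⊔ idealOfVars σ K ^ N) →ₐ[K] K :=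
      Ideal.Quotient.liftₐ _ (aeval (0 : σ → K)) (by
        intro a ha
        have := (aux_mem_m a).1 (hle ha)
        rw [aeval_zero, this]; simp)
    have h1 := aux_chi (χ0.comp Λ) (MvPowerSeries.X i)
    rw [AlgHom.comp_apply, ← hF] at h1
    have h2 : χ0 (Ideal.Quotient.mk _ (F i)) = aeval (0 : σ → K) (F i) := rfl
    rw [h2, aeval_zero] at h1
    rw [aux_mem_m]
    simpa using h1
  have hpoly : ∀ q : MvPolynomial σ K, Λ (q : MvPowerSeries σ K) = Ideal.Quotient.mk _ (φ q) := by
    intro q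
    have : Λ.comp (MvPolynomial.coeToMvPowerSeries.algHom K) =
        (Ideal.Quotient.mkₐ K _).comp φ := by
      ext i
      simp [hφX, hF, coeToMvPowerSeries.algHom_apply]
    have := DFunLike.congr_fun this q
    simpa [coeToMvPowerSeries.algHom_apply] using this
  refine ⟨φ, hφm, hpoly, ?_⟩
  intro q
  rw [← hpoly]
  change Λ q = _
  rw [← sub_eq_zero, ← map_sub]
  refine Submodule.smul_induction_on (aux_ker N q) ?_ ?_
  · intro a ha n _
    have : a • n = (a : MvPowerSeries σ K) * n := rfl
    rw [this, map_mul, hpoly, Ideal.Quotient.eq_zero_iff_mem.2, zero_mul]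
    exact (le_sup_right : idealOfVars σ K ^ N ≤ _) (aux_hom_m φ hφm N a ha)
  · intro x y hx hy
    rw [map_add, hx, hy, add_zero]

lemma aux_main {K : Type*} [Field K] {σ : Type*} [Fintype σ] (h g : MvPolynomial σ K)
    (e : (MvPowerSeries σ K ⧸ Ideal.span {(h : MvPowerSeries σ K)}) ≃ₐ[K]
      MvPowerSeries σ K ⧸ Ideal.span {(g : MvPowerSeries σ K)})
    (h0 : constantCoeff h = 0) (h1 : ∀ i, constantCoeff (pderiv i h) = 0)
    (α : σ → ℕ) (d : ℕ) (hd : (d : K) ≠ 0) (hg : IsWeightedHomogeneous α g d) :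
    ∃ (u : MvPolynomial σ K) (r : σ → MvPolynomial σ K), constantCoeff u ≠ 0 ∧
      (∀ j, constantCoeff (r j) = 0) ∧ u * h = ∑ j, r j * pderiv j h := by
  have hcc : ∀ f : MvPolynomial σ K,
      MvPowerSeries.constantCoeff (f : MvPowerSeries σ K) = constantCoeff f := by
    intro f
    rw [← MvPowerSeries.coeff_zero_eq_constantCoeff_apply, MvPolynomial.coeff_coe]; rfl
  have g0 : constantCoeff g = 0 := by
    by_contra hne
    have hu : IsUnit (g : MvPowerSeries σ K) := by
      rw [MvPowerSeries.isUnit_iff_constantCoeff, hcc]; exact isUnit_iff_ne_zero.2 hne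
    have := Ideal.span_singleton_eq_top.2 hu
    have := Ideal.Quotient.subsingleton_iff.2 this
    have := e.toEquiv.subsingleton
    have := Ideal.Quotient.subsingleton_iff.1 this
    have := Ideal.span_singleton_eq_top.1 this
    rw [MvPowerSeries.isUnit_iff_constantCoeff, hcc, h0] at this
    simp at this
  have hm2 : h ∈ idealOfVars σ K * idealOfVars σ K := by
    rw [← sq, mem_pow_idealOfVars_iff']
    intro x hx
    rcases Nat.lt_or_ge (Finsupp.degree x) 1 with hx1 | hx1
    · have : x = 0 := (Finsupp.degree_eq_zero_iff x).1 (by omega)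
      subst this; exact h0
    · have hx2 : Finsupp.degree x = 1 := by omega
      have hx0 : x ≠ 0 := by rintro rfl; simp at hx2
      obtain ⟨i, hi⟩ := Finsupp.ne_iff.1 hx0
      have hle : Finsupp.single i 1 ≤ x := by
        rw [Finsupp.single_le_iff]; exact Nat.one_le_iff_ne_zero.2 hi
      obtain ⟨y, rfl⟩ := exists_add_of_le hle
      have hy : y = 0 := by
        rw [map_add, Finsupp.degree_single] at hx2
        exact (Finsupp.degree_eq_zero_iff y).1 (by omega)
      subst hy
      have := h1 i
      rw [constantCoeff_eq, coeff_pderiv] at this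
      simpa using this
  apply aux_krull
  intro N
  obtain ⟨φ, hφ, hφ1, hφ2⟩ := aux_lift h g (N + 1) (by omega) g0 e
  obtain ⟨ψ, hψ, hψ1, hψ2⟩ := aux_lift g h (N + 1) (by omega) h0 e.symm
  have hφh : φ h ∈ Ideal.span {g} ⊔ idealOfVars σ K ^ (N + 1) := by
    rw [← Ideal.Quotient.eq_zero_iff_mem, ← hφ1,
      Ideal.Quotient.eq_zero_iff_mem.2 (Ideal.mem_span_singleton_self _)]
    simp
  have hψg : ψ g ∈ Ideal.span {h} ⊔ idealOfVars σ K ^ (N + 1) := by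
    rw [← Ideal.Quotient.eq_zero_iff_mem, ← hψ1,
      Ideal.Quotient.eq_zero_iff_mem.2 (Ideal.mem_span_singleton_self _)]
    simp
  have hψI : ∀ f ∈ Ideal.span {g} ⊔ idealOfVars σ K ^ (N + 1),
      ψ f ∈ Ideal.span {h} ⊔ idealOfVars σ K ^ (N + 1) := by
    intro f hf
    obtain ⟨x, hx, y, hy, rfl⟩ := Submodule.mem_sup.1 hf
    obtain ⟨b, rfl⟩ := Ideal.mem_span_singleton'.1 hx
    rw [map_add, map_mul]
    exact Ideal.add_mem _ (Ideal.mul_mem_left _ _ hψg)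
      ((le_sup_right : idealOfVars σ K ^ (N + 1) ≤ _) (aux_hom_m ψ hψ _ y hy))
  have hθ : ∀ f, ψ (φ f) - f ∈ Ideal.span {h} ⊔ idealOfVars σ K ^ (N + 1) := by
    intro f
    obtain ⟨q, hq⟩ := Ideal.Quotient.mk_surjective (e (Ideal.Quotient.mk _ (f : MvPowerSeries σ K)))
    have e1 := hφ1 f
    change auxTr g (N + 1) (e _) = _ at e1
    rw [← hq, auxTr_mk] at e1
    have e2 := hψ2 q
    change auxTr h (N + 1) (e.symm _) = _ at e2
    rw [hq, AlgEquiv.symm_apply_apply, auxTr_mk_coe] at e2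
    have e3 := hψI _ (Ideal.Quotient.eq.1 e1.symm)
    have e4 := Ideal.Quotient.eq.1 e2.symm
    rw [map_sub] at e3
    have := Ideal.add_mem _ e3 e4
    convert this using 1; ring
  let E : Derivation K (MvPolynomial σ K) (MvPolynomial σ K) :=
    mkDerivation K (fun i => α i • X i)
  have hEX : ∀ i, E (X i) = α i • X i := fun i => mkDerivation_X _ _ _
  have hE : ∀ i, E (X i) ∈ idealOfVars σ K := by
    intro i; rw [aux_mem_m, hEX]; simp
  have hEg : E g = C (d : K) * g := by
    have h2 := aux_chain E (AlgHom.id K _) g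
    simp only [AlgHom.id_apply, hEX] at h2
    have h3 := hg.sum_weight_X_mul_pderiv
    rw [h2, map_natCast, ← nsmul_eq_mul, ← h3]
    refine Finset.sum_congr rfl fun i _ => ?_
    rw [mul_smul_comm, mul_comm]
  have := aux_core h g (N + 1) φ ψ hφ hψ hφh hψg hθ hm2 E hE d hd hEg
  refine (sup_le_sup_left ?_ _ :
    _ ⊔ idealOfVars σ K ^ (N + 1) ≤ _ ⊔ idealOfVars σ K ^ N) this
  exact Ideal.pow_le_pow_right (Nat.le_succ N)


lemma aux_eval_smul {K : Type*} [Field K] {σ : Type*} (G : MvPolynomial σ K) (k : ℕ)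
    (hG : G.IsHomogeneous k) (c : K) (x : σ → K) :
    eval (fun i => c * x i) G = c ^ k * eval x G := by
  rw [eval_eq, eval_eq, Finset.mul_sum]
  refine Finset.sum_congr rfl fun m hm => ?_
  have h1 : Finsupp.degree m = k := by
    have := hG (mem_support_iff.1 hm)
    rw [← this, Finsupp.degree_eq_weight_one]; rfl
  have h2 : ∏ i ∈ m.support, (c * x i) ^ m i = c ^ k * ∏ i ∈ m.support, x i ^ m i := by
    rw [← h1, Finsupp.degree_apply, ← Finset.prod_pow_eq_pow_sum, ← Finset.prod_mul_distrib]
    exact Finset.prod_congr rfl fun i _ => mul_pow _ _ _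
  rw [h2]; ring

lemma aux_dehom {K : Type*} [Field K] [Infinite K] {σ : Type*} (G : MvPolynomial σ K) (k : ℕ)
    (hG : G.IsHomogeneous k) (l : σ) (h : ∀ x : σ → K, x l = 1 → eval x G = 0) : G = 0 := by
  have h1 : X l * G = 0 := by
    apply MvPolynomial.funext
    intro x
    by_cases hx : x l = 0
    · simp [hx]
    · have h2 := h (fun i => (x l)⁻¹ * x i) (inv_mul_cancel₀ hx)
      rw [aux_eval_smul G k hG] at h2
      have h3 : eval x G = 0 := by
        rcases mul_eq_zero.1 h2 with h4 | h4
        · exact absurd h4 (pow_ne_zero _ (inv_ne_zero hx))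
        · exact h4
      simp [h3]
  exact (mul_eq_zero.1 h1).resolve_left (X_ne_zero l)

lemma aux_homog {K : Type*} [Field K] {σ : Type*} (l : σ) (q : MvPolynomial σ K) (D : ℕ)
    (hD : q.totalDegree ≤ D) : ∃ Q : MvPolynomial σ K, Q.IsHomogeneous D ∧
      ∀ x : σ → K, x l = 1 → eval x Q = eval x q := by
  refine ⟨∑ k ∈ Finset.range (D + 1), X l ^ (D - k) * homogeneousComponent k q, ?_, ?_⟩
  · refine IsHomogeneous.sum _ _ _ fun k hk => ?_
    have h1 := (isHomogeneous_X_pow (R := K) l (D - k)).mul (homogeneousComponent_isHomogeneous k q)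
    rwa [Nat.sub_add_cancel (by simpa [Nat.lt_succ_iff] using hk)] at h1
  · intro x hx
    conv_rhs => rw [← sum_homogeneousComponent q]
    simp only [map_sum, map_mul, map_pow, eval_X, hx, one_pow, one_mul]
    symm
    refine Finset.sum_subset (by simpa using hD) ?_
    intro k _ hk
    rw [homogeneousComponent_eq_zero _ _ (by simpa using hk), map_zero]

lemma aux_eval_chart {K : Type*} [Field K] {n : ℕ} (F : MvPolynomial (Fin n) K) (l : Fin n)
    (a x : Fin n → K) (hx : x l = 1) :
    eval (fun i : {i : Fin n // i ≠ l} => x i - a i) (chartPoly F l a) = eval x F := by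
  unfold chartPoly
  induction F using MvPolynomial.induction_on with
  | C c => simp
  | add p q hp hq => simp only [map_add, hp, hq]
  | mul_X p i hp =>
    rw [map_mul, map_mul, map_mul, hp, aeval_X, eval_X]
    by_cases hi : i = l
    · simp [hi, hx]
    · simp [hi]

lemma aux_pderiv_chart {K : Type*} [Field K] {n : ℕ} (F : MvPolynomial (Fin n) K) (l : Fin n)
    (a : Fin n → K) (j : {i : Fin n // i ≠ l}) :
    pderiv j (chartPoly F l a) = chartPoly (pderiv j.1 F) l a := by
  classical
  unfold chartPoly
  rw [aux_chain (pderiv j), Finset.sum_eq_single j.1]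
  · simp [j.2]
  · intro b _ hb
    by_cases hbl : b = l
    · simp [hbl]
    · have : (⟨b, hbl⟩ : {i : Fin n // i ≠ l}) ≠ j := fun h => hb (by rw [← h])
      simp [hbl, pderiv_X_of_ne this]
  · simp

/-- Lemma 4.1: if `a` (normalized with `a_n = 1`) is a weighted homogeneous isolated
singular point, of total degree `d` prime to `p`, of the hypersurface `F = 0` in
`ℙ^{n-1}`, then there are homogeneous `Q, R_1, …, R_{n-1}` with
`Q F = ∑_{j<n} R_j ∂F/∂x_j`, `Q(a) ≠ 0` and `R_j(a) = 0` for all `j`. -/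
theorem statement12 {K : Type*} [Field K] [IsAlgClosed K] (p : ℕ) [CharP K p]
    (hp : p.Prime) {n : ℕ} (hn : 2 ≤ n)
    (F : MvPolynomial (Fin n) K) (δ : ℕ) (hF : F.IsHomogeneous δ)
    (a : Fin n → K) (ha : a ⟨n - 1, by omega⟩ = 1)
    (haF : eval a F = 0)
    (hasing : ∀ i, eval a (pderiv i F) = 0)
    (hiso : IsIsolatedCriticalAtZero (chartPoly F ⟨n - 1, by omega⟩ a))
    (d : ℕ) (hpd : ¬ (p ∣ d))
    (hwh : WeightedHomogSing (chartPoly F ⟨n - 1, by omega⟩ a) d) :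
    ∃ (Q : MvPolynomial (Fin n) K) (R : Fin n → MvPolynomial (Fin n) K),
      (∃ e, Q.IsHomogeneous e) ∧
      (∀ j : Fin n, (j : ℕ) < n - 1 → ∃ e, (R j).IsHomogeneous e) ∧
      Q * F = ∑ j ∈ Finset.univ.filter (fun j : Fin n => (j : ℕ) < n - 1),
        R j * pderiv j F ∧
      eval a Q ≠ 0 ∧
      (∀ j : Fin n, (j : ℕ) < n - 1 → eval a (R j) = 0) := by
  classical
  by_cases hF0 : F = 0
  · exact ⟨1, fun _ => 0, ⟨0, isHomogeneous_one _ _⟩, fun _ _ => ⟨0, isHomogeneous_zero _ _ _⟩,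
      by simp [hF0], by simp, by simp⟩
  have hδ : δ ≠ 0 := by
    rintro rfl
    rw [← totalDegree_zero_iff_isHomogeneous, totalDegree_eq_zero_iff_eq_C] at hF
    rw [hF, eval_C] at haF
    rw [haF, C_0] at hF
    exact hF0 hF
  have hinf : Infinite K := IsAlgClosed.instInfinite
  obtain ⟨l, hl⟩ : ∃ l : Fin n, l = ⟨n - 1, by omega⟩ := ⟨_, rfl⟩
  rw [← hl] at ha hwh
  have hlt : ∀ j : Fin n, (j : ℕ) < n - 1 ↔ j ≠ l := by
    intro j
    rw [hl, Ne, Fin.ext_iff]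
    have := j.2
    simp only
    omega
  obtain ⟨g, ⟨α, -, -, hg⟩, ⟨e⟩⟩ := hwh
  have hd : (d : K) ≠ 0 := by rwa [Ne, CharP.cast_eq_zero_iff K p]
  have hev0 : ∀ G : MvPolynomial (Fin n) K,
      constantCoeff (chartPoly G l a) = eval a G := by
    intro G
    rw [← aux_eval_chart G l a a ha]
    simp only [sub_self]
    rw [← eval_zero']
  obtain ⟨u, r, hu, hr, hur⟩ := aux_main (chartPoly F l a) g e (by rw [hev0, haF])
    (fun i => by rw [aux_pderiv_chart, hev0, hasing]) α d hd hg
  let S : MvPolynomial {i : Fin n // i ≠ l} K →ₐ[K] MvPolynomial (Fin n) K :=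
    aeval (fun i => X i.1 - C (a i.1))
  have hS : ∀ (q : MvPolynomial {i : Fin n // i ≠ l} K) (x : Fin n → K),
      eval x (S q) = eval (fun i : {i : Fin n // i ≠ l} => x i - a i) q := by
    intro q x
    induction q using MvPolynomial.induction_on with
    | C c => simp [S]
    | add p q hp hq => simp only [map_add, hp, hq]
    | mul_X p i hp =>
      rw [map_mul, map_mul, map_mul, hp, eval_X]
      simp [S]
  let D := (S u).totalDegree + ∑ j, (S (r j)).totalDegree
  obtain ⟨Q, hQ, hQe⟩ := aux_homog l (S u) D (Nat.le_add_right _ _)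
  have hR : ∀ j, ∃ R : MvPolynomial (Fin n) K, R.IsHomogeneous (D + 1) ∧
      ∀ x : Fin n → K, x l = 1 → eval x R = eval x (S (r j)) := by
    intro j
    refine aux_homog l (S (r j)) (D + 1) ?_
    have := Finset.single_le_sum (f := fun j => (S (r j)).totalDegree)
      (fun _ _ => Nat.zero_le _) (Finset.mem_univ j)
    omega
  choose R hR hRe using hR
  have hz : ∀ q : MvPolynomial {i : Fin n // i ≠ l} K, eval a (S q) = constantCoeff q := by
    intro q
    rw [hS]
    simp only [sub_self]
    rw [← eval_zero']
  let R' : Fin n → MvPolynomial (Fin n) K := fun j => if h : j ≠ l then R ⟨j, h⟩ else 0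
  have hR' : ∀ j : {i : Fin n // i ≠ l}, R' j = R j := fun j => by simp [R', j.2]
  refine ⟨Q, R', ⟨D, hQ⟩, ?_, ?_, ?_, ?_⟩
  · intro j hj
    exact ⟨D + 1, by rw [hR' ⟨j, (hlt j).1 hj⟩]; exact hR _⟩
  · have hsum : ∑ j ∈ Finset.univ.filter (fun j : Fin n => (j : ℕ) < n - 1), R' j * pderiv j F =
        ∑ j : {i : Fin n // i ≠ l}, R j * pderiv j.1 F := by
      rw [Finset.sum_subtype (p := fun j => j ≠ l) _ (fun j => by simp [hlt])]
      exact Finset.sum_congr rfl fun j _ => by rw [hR']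
    rw [hsum, ← sub_eq_zero]
    apply aux_dehom _ (D + δ) _ l
    · intro x hx
      simp only [map_sub, map_sum, map_mul]
      rw [hQe x hx, hS, ← aux_eval_chart F l a x hx, ← map_mul, hur, map_sum, sub_eq_zero]
      refine Finset.sum_congr rfl fun j _ => ?_
      rw [hRe j x hx, hS, map_mul, aux_pderiv_chart, aux_eval_chart _ l a x hx]
    · refine (hQ.mul hF).sub (IsHomogeneous.sum _ _ _ fun j _ => ?_)
      have := (hR j).mul (hF.pderiv (i := j.1))
      rwa [show D + 1 + (δ - 1) = D + δ by omega] at this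
  · rw [hQe a ha, hz]; exact hu
  · intro j hj
    rw [hR' ⟨j, (hlt j).1 hj⟩, hRe _ a ha, hz, hr]

end
end

section
/- Let F ∈ K[x_1,…,x_n] be homogeneous of degree δ whose hypersurface F = 0 in P^{n−1} has at worst weighted homogeneous isolated singularities a_1,…,a_s, of total degrees d_1,…,d_s, all lying in the chart x_n ≠ 0, with p = char K dividing none of the d_i. Then there exist homogeneous polynomials Q, R_1,…,R_{n−1} ∈ K[x_1,…,x_n] such that Q·F = Σ_{j=1}^{n−1} R_j ∂F/∂x_j, Q(a_i) ≠ 0 for all i = 1,…,s, and R_j(a_i) = 0 for all i = 1,…,s and j = 1,…,n−1. -/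
open MvPolynomial

noncomputable section

namespace S13
variable {K : Type*} [Field K] {σ : Type*}

lemma mem_m (f : MvPolynomial σ K) : f ∈ idealOfVars σ K ↔ eval (0 : σ → K) f = 0 := by
  have h := mem_pow_idealOfVars_iff' 1 f
  rw [pow_one] at h
  rw [h, eval_zero, constantCoeff_eq]
  constructor
  · intro h; exact h 0 (by simp)
  · intro h x hx
    have : x = 0 := by
      rw [← Finsupp.degree_eq_zero_iff]; omega
    rw [this, h]

lemma pderiv_mem (k : σ) (n : ℕ) : ∀ f ∈ (idealOfVars σ K) ^ (n + 1),
    pderiv k f ∈ (idealOfVars σ K) ^ n := by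
  induction n with
  | zero => intro f _; simp
  | succ n ih =>
    intro f hf
    rw [pow_succ] at hf
    induction hf using Submodule.mul_induction_on' with
    | mem_mul_mem a ha b hb =>
      rw [Derivation.leibniz]
      refine Ideal.add_mem _ ?_ ?_
      · exact Ideal.mul_mem_right _ _ ha
      · rw [smul_eq_mul, mul_comm, pow_succ]
        exact Ideal.mul_mem_mul (ih a ha) hb
    | add x _ y _ hx hy => rw [map_add]; exact Ideal.add_mem _ hx hy

lemma chain (τ : Type*) [Fintype σ] (ψ : σ → MvPolynomial τ K) (k : τ) (f : MvPolynomial σ K) :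
    pderiv k (aeval ψ f) = ∑ l, pderiv k (ψ l) * aeval ψ (pderiv l f) := by
  classical
  induction f using MvPolynomial.induction_on with
  | C a => simp
  | add p q hp hq => simp only [map_add, hp, hq, mul_add, Finset.sum_add_distrib]
  | mul_X p i hp =>
    simp only [map_mul, aeval_X, Derivation.leibniz, smul_eq_mul, hp, pderiv_X, map_add]
    simp only [mul_add, Finset.sum_add_distrib, Finset.mul_sum]
    congr 1
    · rw [Finset.sum_eq_single i]
      · simp; ring
      · intro b _ hb; simp [Ne.symm hb]
      · simp
    · refine Finset.sum_congr rfl fun l _ => by ring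

/-- elements outside `m` are units modulo `m^N`. -/
lemma unit_mod (I : Ideal (MvPolynomial σ K)) (N : ℕ) (u x : MvPolynomial σ K)
    (hu : u ∉ idealOfVars σ K) (h : u * x ∈ I ⊔ (idealOfVars σ K) ^ N) :
    x ∈ I ⊔ (idealOfVars σ K) ^ N := by
  set c := eval (0 : σ → K) u with hc
  have hc0 : c ≠ 0 := fun h => hu ((mem_m u).2 h)
  set t := 1 - C c⁻¹ * u with ht
  have htm : t ∈ idealOfVars σ K := by
    rw [mem_m, ht, map_sub, map_mul, map_one, eval_C, ← hc, inv_mul_cancel₀ hc0, sub_self]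
  have h1 : (∑ i ∈ Finset.range N, t ^ i) * (C c⁻¹ * u) = 1 - t ^ N := by
    have := geom_sum_mul_neg t N
    rwa [show 1 - t = C c⁻¹ * u by rw [ht]; ring] at this
  have h2 : x = (∑ i ∈ Finset.range N, t ^ i) * C c⁻¹ * (u * x) + x * t ^ N := by
    linear_combination (-x) * h1
  rw [h2]
  refine Ideal.add_mem _ (Ideal.mul_mem_left _ _ h) ?_
  exact Ideal.mul_mem_left _ _ (Ideal.mem_sup_right (Ideal.pow_mem_pow htm N))

lemma krull [Finite σ] (I : Ideal (MvPolynomial σ K)) (x : MvPolynomial σ K)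
    (h : ∀ N, x ∈ I ⊔ (idealOfVars σ K) ^ N) : ∃ u ∉ idealOfVars σ K, u * x ∈ I := by
  have := (Ideal.mem_iInf_smul_pow_eq_bot_iff (idealOfVars σ K)
    (Ideal.Quotient.mk I x)).1 (by
      rw [Submodule.mem_iInf]
      intro N
      obtain ⟨a, ha, b, hb, hab⟩ := Submodule.mem_sup.1 (h N)
      have : Ideal.Quotient.mk I x = b • (1 : MvPolynomial σ K ⧸ I) := by
        rw [← hab, map_add, Ideal.Quotient.eq_zero_iff_mem.2 ha, zero_add]
        exact (mul_one (Ideal.Quotient.mk I b)).symm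
      rw [this]
      exact Submodule.smul_mem_smul hb trivial)
  obtain ⟨⟨r, hr⟩, hrx⟩ := this
  refine ⟨1 - r, ?_, ?_⟩
  · rw [mem_m] at hr ⊢
    rw [map_sub, map_one, hr, sub_zero]
    exact one_ne_zero
  · rw [← Ideal.Quotient.eq_zero_iff_mem, sub_mul, one_mul, map_sub, map_mul, sub_eq_zero]
    exact hrx.symm

lemma aeval_mem_pow (ψ : σ → MvPolynomial σ K) (hψ : ∀ j, ψ j ∈ idealOfVars σ K) (N : ℕ)
    (f : MvPolynomial σ K) (hf : f ∈ (idealOfVars σ K) ^ N) :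
    aeval ψ f ∈ (idealOfVars σ K) ^ N := by
  have h1 : idealOfVars σ K ≤ (idealOfVars σ K).comap (aeval ψ : MvPolynomial σ K →ₐ[K] _) := by
    rw [Ideal.span_le]
    rintro _ ⟨j, rfl⟩
    simpa using hψ j
  exact (Ideal.pow_right_mono h1 N).trans (Ideal.le_comap_pow _ N) hf

lemma aeval_sub_mem (I : Ideal (MvPolynomial σ K)) (ψ ψ' : σ → MvPolynomial σ K)
    (h : ∀ j, ψ j - ψ' j ∈ I) (f : MvPolynomial σ K) : aeval ψ f - aeval ψ' f ∈ I := by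
  have : (Ideal.Quotient.mkₐ K I).comp (aeval ψ) = (Ideal.Quotient.mkₐ K I).comp (aeval ψ') := by
    ext j
    simpa [Ideal.Quotient.eq] using h j
  have := DFunLike.congr_fun this f
  simpa [Ideal.Quotient.eq] using this

lemma mainPoly [Fintype σ] (h g : MvPolynomial σ K) (N : ℕ) (hN : 2 ≤ N)
    (φ ψ : σ → MvPolynomial σ K)
    (hφ : ∀ j, φ j ∈ idealOfVars σ K) (hψ : ∀ j, ψ j ∈ idealOfVars σ K)
    (hψg : aeval ψ g ∈ Ideal.span {h} ⊔ (idealOfVars σ K) ^ N)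
    (hφh : aeval φ h ∈ Ideal.span {g} ⊔ (idealOfVars σ K) ^ N)
    (hψφ : ∀ j, aeval ψ (φ j) - X j ∈ Ideal.span {h} ⊔ (idealOfVars σ K) ^ N)
    (α : σ → ℕ) (d : ℕ) (hd : (d : K) ≠ 0)
    (hg : ∑ i, α i • (X i * pderiv i g) = d • g)
    (hh2 : h ∈ (idealOfVars σ K) ^ 2) (hhN : h ∉ (idealOfVars σ K) ^ N) :
    h ∈ idealOfVars σ K * Ideal.span (Set.range fun k => pderiv k h)
      ⊔ (idealOfVars σ K) ^ N := by
  classical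
  set m := idealOfVars σ K with hm
  have hprime : m.IsPrime := by
    have : m = RingHom.ker (eval (0 : σ → K)) := by
      ext f; rw [mem_m, RingHom.mem_ker]
    rw [this]; exact RingHom.ker_isPrime _
  set J := Ideal.span (Set.range fun k => pderiv k h) with hJ
  obtain ⟨a, ha, r1, hr1, hψg'⟩ := Submodule.mem_sup.1 hψg
  obtain ⟨w, rfl⟩ := Ideal.mem_span_singleton'.1 ha
  obtain ⟨a', ha', r2, hr2, hφh'⟩ := Submodule.mem_sup.1 hφh
  obtain ⟨w', rfl⟩ := Ideal.mem_span_singleton'.1 ha'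
  set θ : σ → MvPolynomial σ K := fun j => aeval ψ (φ j) with hθ
  have hθc : ∀ f : MvPolynomial σ K, aeval ψ (aeval φ f) = aeval θ f := by
    intro f
    rw [← AlgHom.comp_apply, comp_aeval]
  have hθm : ∀ j, θ j ∈ m := fun j => by
    have := aeval_mem_pow ψ hψ 1 (φ j) (by rw [pow_one]; exact hφ j)
    rwa [pow_one] at this
  have hθsub : ∀ f : MvPolynomial σ K, aeval θ f - f ∈ Ideal.span {h} ⊔ m ^ N := by
    intro f
    have := aeval_sub_mem (Ideal.span {h} ⊔ m ^ N) θ X hψφ f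
    simpa using this
  have hle : (Ideal.span {h} ⊔ m ^ N) * m ≤ m * Ideal.span {h} ⊔ m ^ N := by
    rw [Ideal.sup_mul, mul_comm]
    exact sup_le_sup_left Ideal.mul_le_left _
  have hθ2 : ∀ f ∈ m ^ 2, aeval θ f - f ∈ m * Ideal.span {h} ⊔ m ^ N := by
    intro f hf
    rw [pow_two] at hf
    induction hf using Submodule.mul_induction_on' with
    | mem_mul_mem a ha b hb =>
      have : aeval θ (a * b) - a * b
          = (aeval θ a - a) * aeval θ b + (aeval θ b - b) * a := by
        rw [map_mul]; ring
      rw [this]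
      have hb' := aeval_mem_pow θ hθm 1 b (by rwa [pow_one])
      rw [pow_one] at hb'
      exact Ideal.add_mem _ (hle (Ideal.mul_mem_mul (hθsub a) hb'))
        (hle (Ideal.mul_mem_mul (hθsub b) ha))
    | add x _ y _ hx hy =>
      have : aeval θ (x + y) - (x + y) = (aeval θ x - x) + (aeval θ y - y) := by
        rw [map_add]; ring
      rw [this]; exact Ideal.add_mem _ hx hy
  obtain ⟨c0, hc0, r3, hr3, hθh⟩ := Submodule.mem_sup.1 (hθ2 h hh2)
  obtain ⟨c, hc, rfl⟩ := Ideal.mem_mul_span_singleton.1 hc0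
  have hwm : w ∉ m := by
    intro hw
    have e1 : (1 + c - aeval ψ w' * w) * h ∈ (⊥ : Ideal (MvPolynomial σ K)) ⊔ m ^ N := by
      rw [bot_sup_eq]
      have e2 : aeval θ h = aeval ψ w' * (w * h + r1) + aeval ψ r2 := by
        rw [← hθc, ← hφh', map_add, map_mul, hψg']
      have : (1 + c - aeval ψ w' * w) * h = aeval ψ w' * r1 + aeval ψ r2 - r3 := by
        linear_combination hθh + e2
      rw [this]
      exact Ideal.sub_mem _ (Ideal.add_mem _ (Ideal.mul_mem_left _ _ hr1)
        (aeval_mem_pow ψ hψ N r2 hr2)) hr3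
    have := unit_mod ⊥ N _ h ?_ e1
    · rw [bot_sup_eq] at this
      exact hhN this
    · rw [mem_m] at hw hc ⊢
      rw [map_sub, map_add, map_mul, map_one, hc, hw, mul_zero, add_zero, sub_zero]
      exact one_ne_zero
  have hev : ∀ f : MvPolynomial σ K, eval (0 : σ → K) (aeval ψ f) = eval 0 f := by
    intro f
    induction f using MvPolynomial.induction_on with
    | C a => simp only [algHom_C, algebraMap_eq, eval_C]
    | add p q hp hq => simp only [map_add, hp, hq]
    | mul_X p i hp =>
      have h0 := (mem_m _).1 (hψ i)
      simp only [map_mul, aeval_X, eval_X, hp, h0, Pi.zero_apply]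
  set Jm : Matrix σ σ (MvPolynomial σ K) := Matrix.of fun k l => pderiv k (ψ l) with hJm
  have hdet : Jm.det ∉ m := by
    have hprod : (Jm.map (eval (0 : σ → K))) *
        (Matrix.of fun l j => eval (0 : σ → K) (pderiv l (φ j))) = 1 := by
      ext k j
      have h1 : aeval ψ (φ j) - X j ∈ m ^ 2 := by
        refine (sup_le ?_ (Ideal.pow_le_pow_right hN) : Ideal.span {h} ⊔ m ^ N ≤ m ^ 2) (hψφ j)
        rw [Ideal.span_singleton_le_iff_mem]; exact hh2
      have h2 := pderiv_mem k 1 _ h1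
      rw [pow_one, mem_m, map_sub, map_sub, sub_eq_zero, chain, map_sum, pderiv_X] at h2
      rw [Matrix.mul_apply]
      simp only [map_mul, hev] at h2
      simp only [hJm, Matrix.map_apply, Matrix.of_apply, h2, Matrix.one_apply]
      by_cases hkj : k = j
      · subst hkj; rw [Pi.single_eq_same, map_one, if_pos rfl]
      · rw [Pi.single_eq_of_ne (Ne.symm hkj), map_zero, if_neg hkj]
    intro hm'
    rw [mem_m, RingHom.map_det] at hm'
    have := congrArg Matrix.det hprod
    rw [Matrix.det_mul, Matrix.det_one] at this
    rw [RingHom.mapMatrix_apply] at hm'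
    rw [hm', zero_mul] at this
    exact zero_ne_one this
  obtain ⟨N', rfl⟩ : ∃ N', N = N' + 1 := ⟨N - 1, by omega⟩
  set L := J ⊔ Ideal.span {h} ⊔ m ^ N' with hL
  have hd1 : ∀ k, pderiv k (aeval ψ g) ∈ L := by
    intro k
    rw [← hψg', map_add, Derivation.leibniz]
    refine Ideal.add_mem _ (Ideal.add_mem _ ?_ ?_) ?_
    · exact Ideal.mul_mem_left _ _ (Ideal.mem_sup_left (Ideal.mem_sup_left
        (Ideal.subset_span ⟨k, rfl⟩)))
    · rw [smul_eq_mul]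
      exact Ideal.mul_mem_right _ _ (Ideal.mem_sup_left (Ideal.mem_sup_right
        (Ideal.mem_span_singleton_self h)))
    · exact Ideal.mem_sup_right (pderiv_mem k N' _ hr1)
  have hd2 : ∀ l, Jm.det * aeval ψ (pderiv l g) ∈ L := by
    intro l
    have h1 : Jm.mulVec (fun l => aeval ψ (pderiv l g)) = fun k => pderiv k (aeval ψ g) := by
      ext1 k
      rw [chain]; rfl
    have h2 := congrArg (Matrix.mulVec Jm.adjugate) h1
    rw [Matrix.mulVec_mulVec, Matrix.adjugate_mul, Matrix.smul_mulVec, Matrix.one_mulVec] at h2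
    have h3 := congrFun h2 l
    simp only [Pi.smul_apply, smul_eq_mul] at h3
    rw [h3, Matrix.mulVec, dotProduct]
    exact Ideal.sum_mem _ fun k _ => Ideal.mul_mem_left _ _ (hd1 k)
  have hmL : m * L ≤ (m * J ⊔ m ^ (N' + 1)) ⊔ m * Ideal.span {h} := by
    rw [hL, Ideal.mul_sup, Ideal.mul_sup, ← pow_succ']
    apply le_of_eq
    rw [sup_assoc, sup_assoc, sup_comm (m * Ideal.span {h})]
  have hd3 : (d : MvPolynomial σ K) * Jm.det * (w * h + r1) ∈ m * L := by
    have := congrArg (aeval ψ) hg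
    simp only [map_sum, map_nsmul, map_mul, aeval_X] at this
    rw [hψg']
    have h2 : (d : MvPolynomial σ K) * Jm.det * aeval ψ g
        = ∑ i, α i • (ψ i * (Jm.det * aeval ψ (pderiv i g))) := by
      calc _ = Jm.det * (d • aeval ψ g) := by rw [nsmul_eq_mul]; ring
        _ = _ := by
          rw [← this, Finset.mul_sum]
          refine Finset.sum_congr rfl fun i _ => ?_
          rw [nsmul_eq_mul, nsmul_eq_mul]; ring
    rw [h2]
    exact Ideal.sum_mem _ fun i _ => Submodule.smul_of_tower_mem _ _
      (Ideal.mul_mem_mul (hψ i) (hd2 i))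
  obtain ⟨y, hy, z, hz, hyz⟩ := Submodule.mem_sup.1 (hmL hd3)
  obtain ⟨c', hc', rfl⟩ := Ideal.mem_mul_span_singleton.1 hz
  refine unit_mod (m * J) (N' + 1) ((d : MvPolynomial σ K) * Jm.det * w - c') h ?_ ?_
  · intro hmem
    have h1 : (d : MvPolynomial σ K) * Jm.det * w ∈ m := by
      simpa using Ideal.add_mem _ hmem hc'
    rcases hprime.mem_or_mem h1 with h2 | h2
    · rcases hprime.mem_or_mem h2 with h3 | h3
      · rw [mem_m] at h3
        simp at h3
        exact hd h3
      · exact hdet h3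
    · exact hwm h2
  · have : ((d : MvPolynomial σ K) * Jm.det * w - c') * h
        = y - (d : MvPolynomial σ K) * Jm.det * r1 := by
      linear_combination -hyz
    rw [this]
    exact Ideal.sub_mem _ hy (Ideal.mul_mem_left _ _ (Ideal.mem_sup_right hr1))


lemma ps_mem_pow [Finite σ] (N : ℕ) (s : MvPowerSeries σ K)
    (hs : MvPowerSeries.truncTotal N s = 0) :
    s ∈ (IsLocalRing.maximalIdeal (MvPowerSeries σ K)) ^ N := by
  have h1 : MvPowerSeries.toAdicCompletion σ K s ∈
      ((idealOfVars σ K) ^ N • ⊤ : Submodule (MvPolynomial σ K)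
        (AdicCompletion (idealOfVars σ K) (MvPolynomial σ K))) := by
    rw [AdicCompletion.pow_smul_top_eq_ker_eval (idealOfVars_fg σ K), LinearMap.mem_ker]
    change (MvPowerSeries.toAdicCompletion σ K s).val N = 0
    rw [MvPowerSeries.toAdicCompletion_apply_eq_mk_truncTotal, hs, map_zero]
  have h2 : s ∈ ((idealOfVars σ K) ^ N • ⊤ : Submodule (MvPolynomial σ K)
      (MvPowerSeries σ K)) := by
    have := Submodule.mem_map_of_mem
      (f := ((MvPowerSeries.toAdicCompletionAlgEquiv σ K).symm.toLinearMap)) h1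
    rw [Submodule.map_smul''] at this
    have h3 := Submodule.smul_mono (le_refl ((idealOfVars σ K) ^ N)) (le_top (α := Submodule _ (MvPowerSeries σ K))) this
    have h5 : (MvPowerSeries.toAdicCompletionAlgEquiv σ K).symm.toLinearMap
        (MvPowerSeries.toAdicCompletion σ K s) = s :=
      (MvPowerSeries.toAdicCompletionAlgEquiv σ K).symm_apply_apply s
    rw [h5] at h3
    exact h3
  refine Submodule.smul_induction_on h2 ?_ ?_
  · intro r hr t _
    rw [Algebra.smul_def]
    refine Ideal.mul_mem_right _ _ ?_
    have h4 : idealOfVars σ K ≤ (IsLocalRing.maximalIdeal (MvPowerSeries σ K)).comap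
        (algebraMap (MvPolynomial σ K) (MvPowerSeries σ K)) := by
      rw [Ideal.span_le]
      rintro _ ⟨j, rfl⟩
      simp [MvPowerSeries.algebraMap_apply', MvPowerSeries.isUnit_iff_constantCoeff]
    exact (Ideal.pow_right_mono h4 N).trans (Ideal.le_comap_pow _ N) hr
  · intro x y hx hy; exact Ideal.add_mem _ hx hy

lemma trunc_coe_sub [Finite σ] (N : ℕ) (f : MvPolynomial σ K) :
    MvPowerSeries.truncTotal N (f : MvPowerSeries σ K) - f ∈ (idealOfVars σ K) ^ N := by
  refine (MvPolynomial.mem_pow_idealOfVars_iff' ..).mpr fun x hx ↦ by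
    simp [MvPowerSeries.coeff_truncTotal _ hx]

def resHom [Finite σ] (h : MvPolynomial σ K) (N : ℕ) :
    MvPowerSeries σ K →+* MvPolynomial σ K ⧸ (Ideal.span {h} ⊔ (idealOfVars σ K) ^ N) :=
  (Ideal.Quotient.factor le_sup_right).comp (MvPowerSeries.truncTotalAlgHom σ K N).toRingHom

lemma resHom_apply [Finite σ] (h : MvPolynomial σ K) (N : ℕ) (s : MvPowerSeries σ K) :
    resHom h N s = Ideal.Quotient.mk _ (MvPowerSeries.truncTotal N s) := rfl

lemma resHom_coe [Finite σ] (h : MvPolynomial σ K) (N : ℕ) (f : MvPolynomial σ K) :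
    resHom h N f = Ideal.Quotient.mk _ f := by
  rw [resHom_apply, Ideal.Quotient.eq]
  exact Ideal.mem_sup_right (trunc_coe_sub N f)

def rho [Finite σ] (h : MvPolynomial σ K) (N : ℕ) :
    (MvPowerSeries σ K ⧸ Ideal.span {(h : MvPowerSeries σ K)}) →+*
      MvPolynomial σ K ⧸ (Ideal.span {h} ⊔ (idealOfVars σ K) ^ N) :=
  Ideal.Quotient.lift _ (resHom h N) (by
    intro a ha
    obtain ⟨c, rfl⟩ := Ideal.mem_span_singleton'.1 ha
    rw [map_mul, resHom_coe]
    have : Ideal.Quotient.mk (Ideal.span {h} ⊔ (idealOfVars σ K) ^ N) h = 0 :=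
      Ideal.Quotient.eq_zero_iff_mem.2 (Ideal.mem_sup_left (Ideal.mem_span_singleton_self h))
    rw [this, mul_zero])

lemma rho_mk [Finite σ] (h : MvPolynomial σ K) (N : ℕ) (s : MvPowerSeries σ K) :
    rho h N (Ideal.Quotient.mk _ s) = Ideal.Quotient.mk _ (MvPowerSeries.truncTotal N s) := rfl

lemma rho_coe [Finite σ] (h : MvPolynomial σ K) (N : ℕ) (f : MvPolynomial σ K) :
    rho h N (Ideal.Quotient.mk _ (f : MvPowerSeries σ K)) = Ideal.Quotient.mk _ f :=
  resHom_coe h N f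

lemma quot_nontrivial (h : MvPolynomial σ K) (h0 : h ∈ idealOfVars σ K) :
    Nontrivial (MvPowerSeries σ K ⧸ Ideal.span {(h : MvPowerSeries σ K)}) := by
  rw [Ideal.Quotient.nontrivial_iff, Ne, Ideal.span_singleton_eq_top,
    MvPowerSeries.isUnit_iff_constantCoeff]
  rw [mem_m, eval_zero, constantCoeff_eq] at h0
  rw [← MvPowerSeries.coeff_zero_eq_constantCoeff_apply, MvPolynomial.coeff_coe, h0]
  exact not_isUnit_zero

lemma lift_m (h g : MvPolynomial σ K)
    [Nontrivial (MvPowerSeries σ K ⧸ Ideal.span {(g : MvPowerSeries σ K)})]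
    (e : (MvPowerSeries σ K ⧸ Ideal.span {(g : MvPowerSeries σ K)}) ≃ₐ[K]
      MvPowerSeries σ K ⧸ Ideal.span {(h : MvPowerSeries σ K)})
    (s : MvPowerSeries σ K) (hs : s ∈ IsLocalRing.maximalIdeal (MvPowerSeries σ K)) :
    ∃ t ∈ IsLocalRing.maximalIdeal (MvPowerSeries σ K),
      Ideal.Quotient.mk _ t = e (Ideal.Quotient.mk _ s) := by
  obtain ⟨t, ht⟩ := Ideal.Quotient.mk_surjective (e (Ideal.Quotient.mk _ s))
  refine ⟨t, ?_, ht⟩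
  rw [IsLocalRing.mem_maximalIdeal, mem_nonunits_iff] at hs ⊢
  intro hu
  apply hs
  have h1 := hu.map (Ideal.Quotient.mk (Ideal.span {(h : MvPowerSeries σ K)}))
  rw [ht] at h1
  have h2 := h1.map e.symm
  rw [AlgEquiv.symm_apply_apply] at h2
  have := IsLocalHom.of_surjective (Ideal.Quotient.mk (Ideal.span {(g : MvPowerSeries σ K)}))
    Ideal.Quotient.mk_surjective
  exact isUnit_of_map_unit _ _ h2

lemma trunc_mem [Finite σ] (N : ℕ) (hN : 1 ≤ N) (s : MvPowerSeries σ K)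
    (hs : s ∈ IsLocalRing.maximalIdeal (MvPowerSeries σ K)) :
    MvPowerSeries.truncTotal N s ∈ idealOfVars σ K := by
  rw [IsLocalRing.mem_maximalIdeal, mem_nonunits_iff, MvPowerSeries.isUnit_iff_constantCoeff,
    isUnit_iff_ne_zero, not_not] at hs
  rw [mem_m, eval_zero, constantCoeff_eq, MvPowerSeries.coeff_truncTotal _ (by simpa using (show 0 < N from hN)),
    MvPowerSeries.coeff_zero_eq_constantCoeff_apply, hs]

lemma rho_e_zero [Finite σ] (h g : MvPolynomial σ K)
    [Nontrivial (MvPowerSeries σ K ⧸ Ideal.span {(g : MvPowerSeries σ K)})]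
    (e : (MvPowerSeries σ K ⧸ Ideal.span {(g : MvPowerSeries σ K)}) ≃ₐ[K]
      MvPowerSeries σ K ⧸ Ideal.span {(h : MvPowerSeries σ K)}) (N : ℕ) (hN : 1 ≤ N)
    (s : MvPowerSeries σ K) (hs : s ∈ (IsLocalRing.maximalIdeal (MvPowerSeries σ K)) ^ N) :
    rho h N (e (Ideal.Quotient.mk _ s)) = 0 := by
  set χ : MvPowerSeries σ K →+* _ := ((rho h N).comp (e : _ →+* _)).comp
    (Ideal.Quotient.mk (Ideal.span {(g : MvPowerSeries σ K)})) with hχ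
  have h1 : IsLocalRing.maximalIdeal (MvPowerSeries σ K) ≤
      ((idealOfVars σ K).map (Ideal.Quotient.mk (Ideal.span {h} ⊔ (idealOfVars σ K) ^ N))).comap
        χ := by
    intro t ht
    obtain ⟨t', ht', htt⟩ := lift_m h g e t ht
    rw [Ideal.mem_comap]
    change rho h N (e (Ideal.Quotient.mk _ t)) ∈ _
    rw [← htt, rho_mk]
    exact Ideal.mem_map_of_mem _ (trunc_mem N hN t' ht')
  have h2 := (Ideal.pow_right_mono h1 N).trans (Ideal.le_comap_pow _ N) hs
  rw [Ideal.mem_comap, ← Ideal.map_pow, Ideal.map_mk_eq_bot_of_le le_sup_right] at h2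
  exact h2

lemma exists_psi [Finite σ] (h g : MvPolynomial σ K)
    [Nontrivial (MvPowerSeries σ K ⧸ Ideal.span {(g : MvPowerSeries σ K)})]
    (e : (MvPowerSeries σ K ⧸ Ideal.span {(g : MvPowerSeries σ K)}) ≃ₐ[K]
      MvPowerSeries σ K ⧸ Ideal.span {(h : MvPowerSeries σ K)}) (N : ℕ) (hN : 1 ≤ N) :
    ∃ (ψ : σ → MvPolynomial σ K), (∀ j, ψ j ∈ idealOfVars σ K) ∧
      (∀ j, ∃ s : MvPowerSeries σ K, Ideal.Quotient.mk _ s =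
          e (Ideal.Quotient.mk _ ((X j : MvPolynomial σ K) : MvPowerSeries σ K)) ∧
          s - ψ j ∈ (IsLocalRing.maximalIdeal (MvPowerSeries σ K)) ^ N) ∧
      ∀ f : MvPolynomial σ K, Ideal.Quotient.mk _ (aeval ψ f)
        = rho h N (e (Ideal.Quotient.mk _ (f : MvPowerSeries σ K))) := by
  have hX : ∀ j : σ, ((X j : MvPolynomial σ K) : MvPowerSeries σ K) ∈
      IsLocalRing.maximalIdeal (MvPowerSeries σ K) := by
    intro j
    simp [MvPowerSeries.isUnit_iff_constantCoeff]
  choose t ht hte using fun j => lift_m h g e _ (hX j)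
  refine ⟨fun j => MvPowerSeries.truncTotal N (t j), fun j => trunc_mem N hN _ (ht j),
    fun j => ⟨t j, hte j, ps_mem_pow N _ ?_⟩, ?_⟩
  · ext x
    by_cases hx : x.degree < N
    · rw [MvPowerSeries.coeff_truncTotal _ hx]
      simp [MvPowerSeries.coeff_truncTotal _ hx]
    · rw [MvPowerSeries.coeff_truncTotal_eq_zero _ (not_lt.1 hx)]; simp
  · intro f
    induction f using MvPolynomial.induction_on with
    | C a =>
      have : (Ideal.Quotient.mk (Ideal.span {(g : MvPowerSeries σ K)}))
          ((C a : MvPolynomial σ K) : MvPowerSeries σ K) = algebraMap K _ a := by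
        rw [MvPolynomial.coe_C]; rfl
      rw [this, AlgEquiv.commutes]
      have : algebraMap K (MvPowerSeries σ K ⧸ Ideal.span {(h : MvPowerSeries σ K)}) a
          = Ideal.Quotient.mk _ ((C a : MvPolynomial σ K) : MvPowerSeries σ K) := by
        rw [MvPolynomial.coe_C]; rfl
      rw [this, rho_coe, algHom_C, algebraMap_eq]
    | add p q hp hq => simp only [map_add, hp, hq, MvPolynomial.coe_add]
    | mul_X p i hp =>
      rw [map_mul, map_mul, hp, MvPolynomial.coe_mul, map_mul, map_mul, map_mul, aeval_X,
        ← hte i, rho_mk]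

theorem localMain [Fintype σ] (h g : MvPolynomial σ K) (d : ℕ) (hd : (d : K) ≠ 0)
    (α : σ → ℕ) (hg : IsWeightedHomogeneous α g d)
    (e : (MvPowerSeries σ K ⧸ Ideal.span {(h : MvPowerSeries σ K)}) ≃ₐ[K]
      MvPowerSeries σ K ⧸ Ideal.span {(g : MvPowerSeries σ K)})
    (hh2 : h ∈ (idealOfVars σ K) ^ 2) :
    ∃ (q : MvPolynomial σ K) (r : σ → MvPolynomial σ K),
      eval (0 : σ → K) q ≠ 0 ∧ (∀ j, eval (0 : σ → K) (r j) = 0) ∧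
      q * h = ∑ j, r j * pderiv j h := by
  by_cases hh0 : h = 0
  · exact ⟨1, 0, by simp, by simp, by simp [hh0]⟩
  have hnB := quot_nontrivial h (Ideal.pow_le_self two_ne_zero hh2)
  have hnA := e.symm.toEquiv.nontrivial
  obtain ⟨x, hx⟩ := MvPolynomial.ne_zero_iff.1 hh0
  have hkey : ∀ N, x.degree < N → 2 ≤ N →
      h ∈ idealOfVars σ K * Ideal.span (Set.range fun k => pderiv k h)
      ⊔ (idealOfVars σ K) ^ N := by
    intro N hN hN2
    obtain ⟨ψ, hψ, -, hψf⟩ := exists_psi h g e.symm N (by omega)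
    obtain ⟨φ, hφ, hφs, hφf⟩ := exists_psi g h e N (by omega)
    refine mainPoly h g N hN2 φ ψ hφ hψ ?_ ?_ ?_ α d hd hg.sum_weight_X_mul_pderiv hh2 ?_
    · rw [← Ideal.Quotient.eq_zero_iff_mem, hψf]
      rw [Ideal.Quotient.eq_zero_iff_mem.2 (Ideal.mem_span_singleton_self _), map_zero, map_zero]
    · rw [← Ideal.Quotient.eq_zero_iff_mem, hφf]
      rw [Ideal.Quotient.eq_zero_iff_mem.2 (Ideal.mem_span_singleton_self _), map_zero, map_zero]
    · intro j
      obtain ⟨s, hs, hsφ⟩ := hφs j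
      rw [← Ideal.Quotient.eq, hψf]
      have h1 := rho_e_zero h g e.symm N (by omega) _ hsφ
      rw [map_sub, map_sub, map_sub, sub_eq_zero, hs, AlgEquiv.symm_apply_apply, rho_coe] at h1
      exact h1.symm
    · intro hmem
      exact hx ((mem_pow_idealOfVars_iff' N h).1 hmem x hN)
  obtain ⟨q, hq, hqh⟩ := krull (idealOfVars σ K * Ideal.span (Set.range fun k => pderiv k h)) h (by
    intro N
    have h1 := hkey (N + x.degree + 2) (by omega) (by omega)
    have h2 : (idealOfVars σ K) ^ (N + x.degree + 2) ≤ (idealOfVars σ K) ^ N :=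
      Ideal.pow_le_pow_right (by omega)
    exact (sup_le_sup_left h2
      (idealOfVars σ K * Ideal.span (Set.range fun k => pderiv k h))) h1)
  obtain ⟨r, hr, hrs⟩ := (Submodule.mem_ideal_smul_span_iff_exists_sum
    (idealOfVars σ K) (fun k => pderiv k h) (q * h)).1 hqh
  refine ⟨q, r, fun h0 => hq ((mem_m q).2 h0), fun j => (mem_m _).1 (hr j), ?_⟩
  rw [← hrs, Finsupp.sum_fintype _ _ (by simp)]
  rfl

section geometry

open Classical in
lemma mem_sq [Fintype σ] (h : MvPolynomial σ K) (h0 : eval (0 : σ → K) h = 0)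
    (h1 : ∀ k, eval (0 : σ → K) (pderiv k h) = 0) : h ∈ idealOfVars σ K ^ 2 := by
  have hm := (mem_m h).2 h0
  have hm2 : h ∈ Ideal.span (Set.range (X : σ → MvPolynomial σ K)) := hm
  obtain ⟨c, hc⟩ := (Ideal.mem_span_range_iff_exists_fun).1 hm2
  have hck : ∀ k, eval (0 : σ → K) (c k) = 0 := by
    intro k
    have := h1 k
    rw [← hc, map_sum, map_sum] at this
    simpa [Derivation.leibniz, pderiv_X, Pi.single_apply, apply_ite] using this
  rw [← hc, pow_two]
  refine Ideal.sum_mem _ fun k _ => Ideal.mul_mem_mul ((mem_m _).2 (hck k)) ((mem_m _).2 (by simp))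

variable {n : ℕ}

lemma eval_chart (G : MvPolynomial (Fin n) K) (j : Fin n) (a : Fin n → K)
    (y : {i : Fin n // i ≠ j} → K) :
    eval y (chartPoly G j a) =
      eval (fun i => if h : i = j then 1 else y ⟨i, h⟩ + a i) G := by
  unfold chartPoly
  induction G using MvPolynomial.induction_on with
  | C c => simp
  | add p q hp hq => simp only [map_add, hp, hq]
  | mul_X p i hp =>
    rw [map_mul, map_mul, map_mul, hp]
    congr 1
    by_cases h : i = j <;> simp [h]

lemma eval_chart_zero (G : MvPolynomial (Fin n) K) (j : Fin n) (a : Fin n → K) (ha : a j = 1) :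
    eval 0 (chartPoly G j a) = eval a G := by
  rw [eval_chart]
  congr 2
  funext i
  by_cases h : i = j
  · subst h; simp [ha]
  · simp [h]

lemma chart_pderiv (G : MvPolynomial (Fin n) K) (j : Fin n) (a : Fin n → K)
    (k : {i : Fin n // i ≠ j}) :
    pderiv k (chartPoly G j a) = chartPoly (pderiv k.1 G) j a := by
  unfold chartPoly
  rw [chain, Finset.sum_eq_single k.1]
  · simp [k.2]
  · intro b _ hb
    by_cases h : b = j
    · simp [h]
    · have : (⟨b, h⟩ : {i : Fin n // i ≠ j}) ≠ k := fun h2 => hb (by rw [← h2])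
      simp [h, pderiv_X_of_ne this]
  · simp

lemma chart_surj (j : Fin n) (a : Fin n → K) (f : MvPolynomial {i : Fin n // i ≠ j} K) :
    ∃ e0, ∀ e, e0 ≤ e → ∃ G : MvPolynomial (Fin n) K,
      G.IsHomogeneous e ∧ chartPoly G j a = f := by
  induction f using MvPolynomial.induction_on with
  | C c =>
    exact ⟨0, fun e _ => ⟨C c * X j ^ e, isHomogeneous_C_mul_X_pow c j e, by simp [chartPoly]⟩⟩
  | add p q hp hq =>
    obtain ⟨e1, h1⟩ := hp
    obtain ⟨e2, h2⟩ := hq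
    refine ⟨max e1 e2, fun e he => ?_⟩
    obtain ⟨G1, hG1, rfl⟩ := h1 e (le_trans (le_max_left _ _) he)
    obtain ⟨G2, hG2, rfl⟩ := h2 e (le_trans (le_max_right _ _) he)
    exact ⟨G1 + G2, hG1.add hG2, by simp [chartPoly]⟩
  | mul_X p i hp =>
    obtain ⟨e1, h1⟩ := hp
    refine ⟨e1 + 1, fun e he => ?_⟩
    obtain ⟨e, rfl⟩ : ∃ m, e = m + 1 := ⟨e - 1, by omega⟩
    obtain ⟨G1, hG1, rfl⟩ := h1 e (by omega)
    refine ⟨G1 * (X i.1 - C (a i.1) * X j),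
      hG1.mul ((isHomogeneous_X _ _).sub (isHomogeneous_C_mul_X _ _)), ?_⟩
    unfold chartPoly
    rw [map_mul]
    congr 1
    simp [i.2, algebraMap_eq]

lemma eval_scale (G : MvPolynomial (Fin n) K) (e : ℕ) (hG : G.IsHomogeneous e) (c : K)
    (x : Fin n → K) : eval (fun i => c * x i) G = c ^ e * eval x G := by
  rw [eval_eq, eval_eq, Finset.mul_sum]
  refine Finset.sum_congr rfl fun d hd => ?_
  have h1 := hG.degree_eq_sum_deg_support hd
  have h2 : ∏ i ∈ d.support, (c * x i) ^ d i = c ^ e * ∏ i ∈ d.support, x i ^ d i := by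
    simp_rw [mul_pow]
    rw [Finset.prod_mul_distrib, Finset.prod_pow_eq_pow_sum, h1]
  rw [h2]
  ring

lemma chart_inj [Infinite K] (G : MvPolynomial (Fin n) K) (e : ℕ) (hG : G.IsHomogeneous e)
    (j : Fin n) (a : Fin n → K) (h : chartPoly G j a = 0) : G = 0 := by
  have h1 : X j * G = 0 := by
    apply MvPolynomial.funext
    intro x
    rw [map_mul, eval_X, map_zero]
    by_cases hx : x j = 0
    · simp [hx]
    · have h2 := eval_chart G j a (fun i => (x j)⁻¹ * x i.1 - a i.1)
      rw [h, map_zero] at h2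
      have h3 := eval_scale G e hG (x j)
        (fun i => if h : i = j then 1 else ((x j)⁻¹ * x i - a i) + a i)
      rw [← h2, mul_zero] at h3
      have h4 : (fun i => x j * (if h : i = j then 1 else ((x j)⁻¹ * x i - a i) + a i)) = x := by
        funext i
        by_cases hi : i = j
        · simp [hi]
        · simp [hi, hx]
      rw [h4] at h3
      rw [h3, mul_zero]
  exact (mul_eq_zero.1 h1).resolve_left (X_ne_zero j)

lemma pointMain [Infinite K] (F : MvPolynomial (Fin n) K) (δ : ℕ) (hF : F.IsHomogeneous δ)
    (j : Fin n) (a : Fin n → K) (ha : a j = 1) (haF : eval a F = 0)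
    (hcrit : ∀ i, eval 0 (pderiv i (chartPoly F j a)) = 0) (d : ℕ) (hd : (d : K) ≠ 0)
    (hw : WeightedHomogSing (chartPoly F j a) d) :
    ∃ e0, ∀ e, e0 ≤ e → ∃ (Q : MvPolynomial (Fin n) K) (R : Fin n → MvPolynomial (Fin n) K),
      Q.IsHomogeneous e ∧ (∀ k, (R k).IsHomogeneous (e + 1)) ∧ R j = 0 ∧
      Q * F = ∑ k, R k * pderiv k F ∧ eval a Q ≠ 0 ∧ ∀ k, eval a (R k) = 0 := by
  by_cases hδ : δ = 0
  · subst hδ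
    have hF0 : F = 0 := by
      rw [← totalDegree_zero_iff_isHomogeneous, totalDegree_eq_zero_iff_eq_C] at hF
      rw [hF, eval_C] at haF
      rw [hF, haF, C_0]
    refine ⟨0, fun e _ => ⟨X j ^ e, 0, isHomogeneous_X_pow j e, fun k => isHomogeneous_zero _ _ _,
      rfl, by simp [hF0], by simp [ha], by simp⟩⟩
  obtain ⟨g, ⟨α, -, -, hg⟩, ⟨E⟩⟩ := hw
  have h0 : eval 0 (chartPoly F j a) = 0 := by rw [eval_chart_zero _ _ _ ha, haF]
  obtain ⟨q, r, hq, hr, hqr⟩ := localMain _ g d hd α hg E (mem_sq _ h0 hcrit)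
  obtain ⟨eq, heq⟩ := chart_surj j a q
  choose er her using fun k => chart_surj j a (r k)
  refine ⟨eq + ∑ k, er k, fun e he => ?_⟩
  obtain ⟨Q, hQ, hQq⟩ := heq e (by omega)
  have hle : ∀ k, er k ≤ e + 1 := fun k => by
    have := Finset.single_le_sum (f := er) (fun i _ => Nat.zero_le _) (Finset.mem_univ k)
    omega
  choose R hR hRr using fun k => her k (e + 1) (hle k)
  set R2 : Fin n → MvPolynomial (Fin n) K := fun k => if h : k = j then 0 else R ⟨k, h⟩ with hR2
  have hR2h : ∀ k, (R2 k).IsHomogeneous (e + 1) := by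
    intro k
    by_cases h : k = j
    · simp only [hR2, h, dite_true]; exact isHomogeneous_zero _ _ _
    · simp only [hR2, h, dite_false]; exact hR _
  have hR2j : R2 j = 0 := by simp [hR2]
  have hR2s : ∀ k : {i : Fin n // i ≠ j}, R2 k.1 = R k := by
    intro k; simp [hR2, k.2]
  refine ⟨Q, R2, hQ, hR2h, hR2j, ?_, ?_, ?_⟩
  · rw [← sub_eq_zero]
    refine chart_inj _ (e + δ) ?_ j a ?_
    · refine (hQ.mul hF).sub (IsHomogeneous.sum _ _ _ fun k _ => ?_)
      have := (hR2h k).mul (hF.pderiv (i := k))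
      rwa [show e + 1 + (δ - 1) = e + δ by omega] at this
    · have hc : ∀ G, chartPoly G j a = aeval (fun i : Fin n => if h : i = j then
        (1 : MvPolynomial {i : Fin n // i ≠ j} K) else X ⟨i, h⟩ + C (a i)) G := fun G => rfl
      rw [hc, map_sub, map_mul, map_sum, ← hc, ← hc, hQq, hqr, sub_eq_zero,
        Fintype.sum_eq_add_sum_subtype_ne _ j, hR2j, zero_mul, map_zero, zero_add]
      refine Finset.sum_congr rfl fun k _ => ?_
      rw [map_mul, ← hc, ← hc, hR2s, hRr, chart_pderiv]
  · rw [← eval_chart_zero _ j _ ha, hQq]; exact hq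
  · intro k
    by_cases h : k = j
    · rw [h, hR2j, map_zero]
    · have := hR2s ⟨k, h⟩
      simp only at this
      rw [this, ← eval_chart_zero _ j _ ha, hRr]; exact hr _

lemma separator {s : ℕ} (a : Fin s → (Fin n → K)) (hainj : Function.Injective a) (j : Fin n)
    (ha : ∀ i, a i j = 1) (i : Fin s) : ∃ L : MvPolynomial (Fin n) K,
      L.IsHomogeneous (s - 1) ∧ eval (a i) L ≠ 0 ∧ ∀ k, k ≠ i → eval (a k) L = 0 := by
  have h1 : ∀ k, ∃ m, k ≠ i → a i m ≠ a k m := by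
    intro k
    by_cases h : k = i
    · exact ⟨j, fun h2 => absurd h h2⟩
    · by_contra! hcon
      exact h (hainj (funext fun m => ((hcon m).2).symm))
  choose m hm using h1
  refine ⟨∏ k ∈ Finset.univ.erase i, (X (m k) - C (a k (m k)) * X j), ?_, ?_, ?_⟩
  · have := IsHomogeneous.prod (Finset.univ.erase i)
      (fun k => (X (m k) - C (a k (m k)) * X j : MvPolynomial (Fin n) K)) (fun _ => 1)
      (fun k _ => (isHomogeneous_X _ _).sub (isHomogeneous_C_mul_X _ _))
    simpa using this
  · rw [map_prod, Finset.prod_ne_zero_iff]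
    intro k hk
    simp only [map_sub, map_mul, eval_X, eval_C, ha, mul_one]
    exact sub_ne_zero.2 (hm k (Finset.ne_of_mem_erase hk))
  · intro k hk
    rw [map_prod]
    refine Finset.prod_eq_zero (Finset.mem_erase.2 ⟨hk, Finset.mem_univ k⟩) ?_
    simp [ha]

theorem final [Infinite K] (p : ℕ) [CharP K p] (F : MvPolynomial (Fin n) K) (δ : ℕ)
    (hF : F.IsHomogeneous δ) (j : Fin n) (s : ℕ) (a : Fin s → (Fin n → K))
    (hainj : Function.Injective a) (ha : ∀ i, a i j = 1) (haF : ∀ i, eval (a i) F = 0)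
    (hiso : ∀ i, IsIsolatedCriticalAtZero (chartPoly F j (a i)))
    (d : Fin s → ℕ) (hpd : ∀ i, ¬ (p ∣ d i))
    (hwh : ∀ i, WeightedHomogSing (chartPoly F j (a i)) (d i)) :
    ∃ (Q : MvPolynomial (Fin n) K) (R : Fin n → MvPolynomial (Fin n) K),
      (∃ e, Q.IsHomogeneous e) ∧ (∀ k, ∃ e, (R k).IsHomogeneous e) ∧ R j = 0 ∧
      Q * F = ∑ k, R k * pderiv k F ∧ (∀ i, eval (a i) Q ≠ 0) ∧
      (∀ i k, eval (a i) (R k) = 0) := by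
  choose e0 he0 using fun i => pointMain F δ hF j (a i) (ha i) (haF i) (hiso i).1 (d i)
    (fun h => hpd i ((CharP.cast_eq_zero_iff K p _).1 h)) (hwh i)
  have hle : ∀ i, e0 i ≤ ∑ k, e0 k := fun i =>
    Finset.single_le_sum (f := e0) (fun i _ => Nat.zero_le _) (Finset.mem_univ i)
  choose Q R hQ hR hRj hQR hQa hRa using fun i => he0 i _ (hle i)
  choose L hL hLi hLk using separator a hainj j ha
  refine ⟨∑ i, L i * Q i, fun k => ∑ i, L i * R i k, ⟨_, IsHomogeneous.sum _ _ _ fun i _ =>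
    (hL i).mul (hQ i)⟩, fun k => ⟨_, IsHomogeneous.sum _ _ _ fun i _ => (hL i).mul (hR i k)⟩,
    by simp [hRj], ?_, ?_, ?_⟩
  · simp_rw [Finset.sum_mul]
    rw [Finset.sum_comm]
    refine Finset.sum_congr rfl fun i _ => ?_
    rw [mul_assoc, hQR, Finset.mul_sum]
    simp_rw [mul_assoc]
  · intro i
    rw [map_sum, Finset.sum_eq_single i]
    · rw [map_mul]; exact mul_ne_zero (hLi i) (hQa i)
    · intro k _ hk
      rw [map_mul, hLk k i hk.symm, zero_mul]
    · simp
  · intro i k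
    rw [map_sum]
    refine Finset.sum_eq_zero fun l _ => ?_
    by_cases h : i = l
    · subst h; rw [map_mul, hRa, mul_zero]
    · rw [map_mul, hLk l i h, zero_mul]

end geometry

end S13

/-- Corollary 4.5: if the hypersurface `F = 0` in `ℙ^{n-1}` has at worst weighted
homogeneous isolated singularities `a_1, …, a_s` (all normalized in the chart `x_n = 1`,
of total degrees `d_i` prime to `p`), then there are homogeneous `Q, R_1, …, R_{n-1}`
with `Q F = ∑_{j<n} R_j ∂F/∂x_j`, `Q(a_i) ≠ 0` for all `i`, and `R_j(a_i) = 0`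
for all `i, j`. -/
theorem statement13 {K : Type*} [Field K] [IsAlgClosed K] (p : ℕ) [CharP K p]
    (hp : p.Prime) {n : ℕ} (hn : 2 ≤ n)
    (F : MvPolynomial (Fin n) K) (δ : ℕ) (hF : F.IsHomogeneous δ)
    (s : ℕ) (a : Fin s → (Fin n → K)) (hainj : Function.Injective a)
    (ha : ∀ i, a i ⟨n - 1, by omega⟩ = 1)
    (haF : ∀ i, eval (a i) F = 0)
    (hasing : ∀ i j, eval (a i) (pderiv j F) = 0)
    (hall : ∀ x : Fin n → K, x ≠ 0 → eval x F = 0 →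
      (∀ j, eval x (pderiv j F) = 0) → ∃ (i : Fin s) (c : K), c ≠ 0 ∧ x = c • a i)
    (hiso : ∀ i, IsIsolatedCriticalAtZero (chartPoly F ⟨n - 1, by omega⟩ (a i)))
    (d : Fin s → ℕ) (hpd : ∀ i, ¬ (p ∣ d i))
    (hwh : ∀ i, WeightedHomogSing (chartPoly F ⟨n - 1, by omega⟩ (a i)) (d i)) :
    ∃ (Q : MvPolynomial (Fin n) K) (R : Fin n → MvPolynomial (Fin n) K),
      (∃ e, Q.IsHomogeneous e) ∧
      (∀ j : Fin n, (j : ℕ) < n - 1 → ∃ e, (R j).IsHomogeneous e) ∧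
      Q * F = ∑ j ∈ Finset.univ.filter (fun j : Fin n => (j : ℕ) < n - 1),
        R j * pderiv j F ∧
      (∀ i, eval (a i) Q ≠ 0) ∧
      (∀ i, ∀ j : Fin n, (j : ℕ) < n - 1 → eval (a i) (R j) = 0) := by
  haveI : Infinite K := IsAlgClosed.instInfinite
  obtain ⟨Q, R, hQ, hR, hRj, hQR, hQa, hRa⟩ := S13.final p F δ hF ⟨n - 1, by omega⟩ s a hainj ha
    haF hiso d hpd hwh
  refine ⟨Q, R, hQ, fun k _ => hR k, ?_, hQa, fun i k _ => hRa i k⟩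
  rw [hQR, Finset.sum_filter]
  refine Finset.sum_congr rfl fun k _ => ?_
  split_ifs with hk
  · rfl
  · have : k = ⟨n - 1, by omega⟩ := Fin.ext (by have := k.2; simp only; omega)
    rw [this, hRj, zero_mul]

end
end

section
/- Let F ∈ K[x_1,…,x_n] be homogeneous of degree δ with p = char K dividing δ. Suppose the set of common zeros of ∂F/∂x_1,…,∂F/∂x_n in P^{n−1} is finite, and that F̃(x_1,…,x_{n−1}) := F(x_1,…,x_{n−1},0) defines a smooth hypersurface in P^{n−2}. Then ∂F/∂x_1,…,∂F/∂x_{n−1} form a regular sequence in K[x_1,…,x_n]. -/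
open MvPolynomial

noncomputable section

open IsLocalRing RingTheory.Sequence in
/-- depth at least `d`. -/
def DG (A : Type*) [CommRing A] [IsLocalRing A] (M : Type*) [AddCommGroup M] [Module A M]
    (d : ℕ) : Prop :=
  ∃ rs : List A, rs.length = d ∧ (∀ r ∈ rs, r ∈ maximalIdeal A) ∧ IsWeaklyRegular M rs

section local_part
open IsLocalRing RingTheory.Sequence Pointwise

theorem DG_succ {A : Type*} [CommRing A] [IsLocalRing A]
    {M : Type*} [AddCommGroup M] [Module A M] (d : ℕ) :
    DG A M (d + 1) ↔ ∃ x ∈ maximalIdeal A, IsSMulRegular M x ∧ DG A (QuotSMulTop x M) d := by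
  constructor
  · rintro ⟨rs, hl, hm, hr⟩
    match rs, hl with
    | x :: rs, hl =>
      rw [isWeaklyRegular_cons_iff] at hr
      exact ⟨x, hm x (by simp), hr.1, rs, by simpa using hl,
        fun r h => hm r (by simp [h]), hr.2⟩
  · rintro ⟨x, hx, hxr, rs, hl, hm, hr⟩
    refine ⟨x :: rs, by simp [hl], ?_, ?_⟩
    · simpa only [List.forall_mem_cons] using ⟨hx, hm⟩
    · rw [isWeaklyRegular_cons_iff]; exact ⟨hxr, hr⟩

theorem avoid (K : Type*) [Field K] [Infinite K] {A : Type*} [CommRing A]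
    [IsNoetherianRing A] [Algebra K A]
    {M : Type*} [AddCommGroup M] [Module A M] [Module.Finite A M]
    (J : Ideal A) (g : A) :
    (∃ j ∈ J, IsSMulRegular M (g + j)) ∨
      ∃ u : M, u ≠ 0 ∧ ∀ a ∈ J ⊔ Ideal.span {g}, a • u = 0 := by
  classical
  by_contra! hcon
  obtain ⟨h1, h2⟩ := hcon
  have hfin := associatedPrimes.finite A M
  let E := (J.restrictScalars K) × K
  let φ : E →ₗ[K] A := (J.restrictScalars K).subtype.coprod (LinearMap.toSpanSingleton K A g)
  have hφ : ∀ (j : J.restrictScalars K) (c : K), φ (j, c) = (j : A) + c • g := fun _ _ => rfl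
  let s : Finset (Subspace K E) :=
    insert (LinearMap.ker (LinearMap.snd K (J.restrictScalars K) K))
      (hfin.toFinset.image fun P => (P.restrictScalars K).comap φ)
  have hs : ⊤ ∉ s := by
    intro h
    rw [Finset.mem_insert] at h
    rcases h with h | h
    · have : ((0, 1) : E) ∈ (⊤ : Subspace K E) := trivial
      rw [h] at this
      simp at this
    · rw [Finset.mem_image] at h
      obtain ⟨P, hP, hPt⟩ := h
      have hP' : IsAssociatedPrime P M := hfin.mem_toFinset.1 hP
      have key : ∀ e : E, φ e ∈ P := by
        intro e
        have : e ∈ (⊤ : Subspace K E) := trivial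
        rw [← hPt] at this
        simpa using this
      have hJ : J ≤ P := by
        intro j hj
        have := key (⟨j, hj⟩, 0)
        simpa [hφ] using this
      have hg : g ∈ P := by
        have := key (0, 1)
        simpa [hφ] using this
      rw [isAssociatedPrime_iff] at hP'
      obtain ⟨hPp, u, hu⟩ := hP'
      have hu0 : u ≠ 0 := by
        rintro rfl
        apply hPp.ne_top
        rw [hu]; simp
      obtain ⟨a, ha, hau⟩ := h2 u hu0
      apply hau
      have : a ∈ P := (sup_le hJ (by simpa [Ideal.span_le] using hg)) ha
      rw [hu] at this
      simpa [Submodule.mem_colon_singleton] using this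
  apply Subspace.biUnion_ne_univ_of_top_notMem hs
  rw [Set.eq_univ_iff_forall]
  rintro ⟨j, c⟩
  by_cases hc : c = 0
  · simp only [Set.mem_iUnion]
    refine ⟨_, Finset.mem_insert_self _ _, ?_⟩
    exact hc
  · have hr := h1 (algebraMap K A c⁻¹ * j) (J.mul_mem_left _ j.2)
    have : (g + algebraMap K A c⁻¹ * j) ∈ ⋃ p ∈ associatedPrimes A M, (p : Set A) := by
      rw [biUnion_associatedPrimes_eq_compl_regular]
      exact hr
    simp only [Set.mem_iUnion] at this
    obtain ⟨P, hP, hmem⟩ := this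
    simp only [Set.mem_iUnion]
    refine ⟨_, Finset.mem_insert_of_mem (Finset.mem_image_of_mem _ (hfin.mem_toFinset.2 hP)), ?_⟩
    have h3 : algebraMap K A c * (g + algebraMap K A c⁻¹ * j) ∈ P := P.mul_mem_left _ hmem
    have h4 : algebraMap K A c * (g + algebraMap K A c⁻¹ * j) = φ (j, c) := by
      simp only [hφ, Algebra.smul_def, mul_add, ← mul_assoc, ← map_mul]
      rw [mul_inv_cancel₀ hc]; simp [add_comm]
    rw [h4] at h3
    simpa using h3

theorem rees (K : Type*) [Field K] [Infinite K] {A : Type*} [CommRing A] [IsLocalRing A]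
    [IsNoetherianRing A] [Algebra K A]
    : ∀ (d : ℕ) {M : Type*} [AddCommGroup M] [Module A M] [Module.Finite A M]
    (y : A), y ∈ maximalIdeal A → IsSMulRegular M y → DG A M (d + 1) → 
    DG A (QuotSMulTop y M) d := by
  intro d
  induction d with
  | zero => intro M _ _ _ y _ _ _; exact ⟨[], by simp⟩
  | succ d ih =>
    intro M _ _ _ y hy hyr hD
    have : IsNoetherian A M := isNoetherian_of_isNoetherianRing_of_finite A M
    rw [DG_succ] at hD
    obtain ⟨x, hx, hxr, hD⟩ := hD
    obtain ⟨w, hw, hwr, -⟩ := (DG_succ d).1 hD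
    have soc1 : ∀ u : QuotSMulTop x M, (∀ a ∈ maximalIdeal A, a • u = 0) → u = 0 := by
      intro u hu
      exact hwr.right_eq_zero_of_smul (hu w hw)
    have soc2 : ∀ u : QuotSMulTop y M, (∀ a ∈ maximalIdeal A, a • u = 0) → u = 0 := by
      intro u hu
      obtain ⟨m, rfl⟩ := Submodule.Quotient.mk_surjective _ u
      have hu' : ∀ a ∈ maximalIdeal A, ∃ ma : M, y • ma = a • m := by
        intro a ha
        have := hu a ha
        rw [← Submodule.Quotient.mk_smul, Submodule.Quotient.mk_eq_zero,
          Submodule.mem_smul_pointwise_iff_exists] at this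
        obtain ⟨ma, -, h⟩ := this
        exact ⟨ma, h⟩
      obtain ⟨ma, hm'⟩ := hu' x hx
      have h0 : (Submodule.Quotient.mk ma : QuotSMulTop x M) = 0 := by
        apply soc1
        intro a ha
        obtain ⟨mb, hmb⟩ := hu' a ha
        rw [← Submodule.Quotient.mk_smul, Submodule.Quotient.mk_eq_zero,
          Submodule.mem_smul_pointwise_iff_exists]
        refine ⟨mb, trivial, hyr ?_⟩
        change y • x • mb = y • a • ma
        rw [smul_comm y a, hm', smul_comm y x, hmb, smul_comm]
      rw [Submodule.Quotient.mk_eq_zero, Submodule.mem_smul_pointwise_iff_exists] at h0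
      obtain ⟨m₃, -, hm₃⟩ := h0
      rw [Submodule.Quotient.mk_eq_zero, Submodule.mem_smul_pointwise_iff_exists]
      refine ⟨m₃, trivial, hxr ?_⟩
      change x • y • m₃ = x • m
      rw [← hm', ← hm₃, smul_comm]
    obtain ⟨z, hz, hz1, hz2⟩ : ∃ z ∈ maximalIdeal A, IsSMulRegular (QuotSMulTop x M) z ∧
        IsSMulRegular (QuotSMulTop y M) z := by
      rcases avoid K (M := QuotSMulTop x M × QuotSMulTop y M) (maximalIdeal A) 0 with
        ⟨j, hj, hreg⟩ | ⟨u, hu, hu'⟩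
      · rw [zero_add] at hreg
        refine ⟨j, hj, ?_, ?_⟩
        · intro a b hab
          have := @hreg (a, 0) (b, 0) (by simpa using hab)
          simpa using this
        · intro a b hab
          have := @hreg (0, a) (0, b) (by simpa using hab)
          simpa using this
      · exfalso
        apply hu
        ext1
        · exact soc1 _ fun a ha => congrArg Prod.fst (hu' a (Ideal.mem_sup_left ha))
        · exact soc2 _ fun a ha => congrArg Prod.snd (hu' a (Ideal.mem_sup_left ha))
    obtain ⟨ts, hl, htm, htr⟩ := ih (M := QuotSMulTop x M) z hz hz1 hD
    have r1 : IsWeaklyRegular M (x :: z :: ts) := by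
      rw [isWeaklyRegular_cons_iff, isWeaklyRegular_cons_iff]
      exact ⟨hxr, hz1, htr⟩
    have r2 : IsWeaklyRegular M (z :: x :: ts) :=
      IsLocalRing.isWeaklyRegular_of_perm_of_subset_maximalIdeal r1 (List.Perm.swap _ _ _)
        (by simpa only [List.forall_mem_cons] using ⟨hx, hz, htm⟩)
    have r3 : IsWeaklyRegular M (z :: [y]) :=
      IsLocalRing.isWeaklyRegular_of_perm_of_subset_maximalIdeal (rs := [y, z])
        (by rw [isWeaklyRegular_cons_iff, isWeaklyRegular_cons_iff]; exact ⟨hyr, hz2, by simp⟩)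
        (List.Perm.swap _ _ _) (by simpa only [List.forall_mem_cons] using ⟨hy, hz, by simp⟩)
    rw [isWeaklyRegular_cons_iff] at r2
    rw [isWeaklyRegular_cons_iff, isWeaklyRegular_cons_iff] at r3
    obtain ⟨ts', hl', htm', htr'⟩ := ih (M := QuotSMulTop z M) y hy r3.2.1
      ⟨x :: ts, by simp [hl], by simpa only [List.forall_mem_cons] using ⟨hx, htm⟩, r2.2⟩
    have r4 : IsWeaklyRegular M (z :: y :: ts') := by
      rw [isWeaklyRegular_cons_iff, isWeaklyRegular_cons_iff]
      exact ⟨r2.1, r3.2.1, htr'⟩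
    have r5 : IsWeaklyRegular M (y :: z :: ts') :=
      IsLocalRing.isWeaklyRegular_of_perm_of_subset_maximalIdeal r4 (List.Perm.swap _ _ _)
        (by simpa only [List.forall_mem_cons] using ⟨hz, hy, htm'⟩)
    rw [isWeaklyRegular_cons_iff] at r5
    exact ⟨z :: ts', by simp [hl'], by simpa only [List.forall_mem_cons] using ⟨hz, htm'⟩, r5.2⟩

theorem not_DG_of_rad {A : Type*} [CommRing A] [IsLocalRing A]
    {M : Type*} [AddCommGroup M] [Module A M] (d : ℕ) (P : Ideal A) (u : M)
    (hu : u ≠ 0) (hP : ∀ a ∈ P, a • u = 0) (hrad : maximalIdeal A ≤ P.radical) :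
    ¬ DG A M (d + 1) := by
  rw [DG_succ]
  rintro ⟨x, hx, hxr, -⟩
  obtain ⟨N, hN⟩ := hrad hx
  exact hu ((hxr.pow N).right_eq_zero_of_smul (hP _ hN))

theorem lemmaA (K : Type*) [Field K] [Infinite K] {A : Type*} [CommRing A] [IsLocalRing A]
    [IsNoetherianRing A] [Algebra K A]
    : ∀ (gs : List A), (∀ g ∈ gs, g ∈ maximalIdeal A) →
    ∀ {M : Type*} [AddCommGroup M] [Module A M] [Module.Finite A M] (P : Ideal A) (u : M),
    u ≠ 0 → (∀ a ∈ P, a • u = 0) → maximalIdeal A ≤ (P ⊔ Ideal.ofList gs).radical →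
    ¬ DG A M (gs.length + 1) := by
  intro gs
  induction gs with
  | nil =>
    intro _ M _ _ _ P u hu hP hrad
    exact not_DG_of_rad _ P u hu hP (by simpa using hrad)
  | cons g gs ih =>
    intro hgs M _ _ _ P u hu hP hrad hD
    have : IsNoetherian A M := isNoetherian_of_isNoetherianRing_of_finite A M
    have hPm : P ≤ maximalIdeal A := by
      apply IsLocalRing.le_maximalIdeal
      rintro rfl
      exact hu (by simpa using hP 1 trivial)
    have hgm : Ideal.ofList gs ≤ maximalIdeal A := by
      rw [Ideal.ofList, Ideal.span_le]
      intro g hg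
      exact hgs g (by simp at hg; simp [hg])
    rcases avoid K (M := M) (P ⊔ Ideal.ofList gs) g with ⟨j, hj, hreg⟩ | ⟨v, hv, hv'⟩
    · have hxm : g + j ∈ maximalIdeal A :=
        add_mem (hgs g (by simp)) ((sup_le hPm hgm) hj)
      have hD' := rees K _ (g + j) hxm hreg hD
      let U : Submodule A M :=
        { carrier := {v | ∀ a ∈ P, a • v = 0}
          add_mem' := by
            intro v w hv hw a ha
            rw [smul_add, hv a ha, hw a ha, add_zero]
          zero_mem' := by intro a _; simp
          smul_mem' := by
            intro c v hv a ha
            rw [smul_comm, hv a ha, smul_zero] }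
      have hex : ∃ v ∈ U, v ∉ (g + j) • (⊤ : Submodule A M) := by
        by_contra! hcon
        have hU : U = ⊥ := by
          apply Submodule.eq_bot_of_le_smul_of_le_jacobson_bot (Ideal.span {g + j}) U
            (IsNoetherian.noetherian U)
          · intro v hv
            have := hcon v hv
            rw [Submodule.mem_smul_pointwise_iff_exists] at this
            obtain ⟨w, -, rfl⟩ := this
            refine Submodule.smul_mem_smul (Ideal.mem_span_singleton_self _) ?_
            intro a ha
            apply hreg.right_eq_zero_of_smul
            rw [smul_comm]
            exact hv a ha
          · rw [IsLocalRing.jacobson_eq_maximalIdeal _ bot_ne_top, Ideal.span_le]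
            simpa using hxm
        have : u ∈ U := hP
        rw [hU] at this
        exact hu (by simpa using this)
      obtain ⟨v, hvU, hv⟩ := hex
      refine ih (fun g hg => hgs g (by simp [hg])) (M := QuotSMulTop (g + j) M)
        (P ⊔ Ideal.span {g + j}) (Submodule.Quotient.mk v) ?_ ?_ ?_ hD'
      · rwa [ne_eq, Submodule.Quotient.mk_eq_zero]
      · have : P ⊔ Ideal.span {g + j} ≤ Module.annihilator A (Submodule.span A {(Submodule.Quotient.mk v : QuotSMulTop (g + j) M)}) := by
          apply sup_le
          · intro a ha
            rw [Submodule.mem_annihilator_span_singleton, ← Submodule.Quotient.mk_smul, hvU a ha]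
            rfl
          · rw [Ideal.span_le]
            simp only [Set.singleton_subset_iff, SetLike.mem_coe]
            rw [Submodule.mem_annihilator_span_singleton, ← Submodule.Quotient.mk_smul,
              Submodule.Quotient.mk_eq_zero]
            exact Submodule.smul_mem_pointwise_smul _ _ _ trivial
        intro a ha
        exact (Submodule.mem_annihilator_span_singleton _ _).1 (this ha)
      · refine hrad.trans (Ideal.radical_mono ?_)
        have hle : P ⊔ Ideal.ofList gs ≤ P ⊔ Ideal.span {g + j} ⊔ Ideal.ofList gs :=
          sup_le_sup_right le_sup_left _
        rw [Ideal.ofList_cons]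
        refine sup_le (le_sup_left.trans hle) (sup_le ?_ le_sup_right)
        rw [Ideal.span_le]
        simp only [Set.singleton_subset_iff, SetLike.mem_coe]
        have h1 : g + j ∈ P ⊔ Ideal.span {g + j} ⊔ Ideal.ofList gs :=
          Ideal.mem_sup_left (Ideal.mem_sup_right (Ideal.mem_span_singleton_self _))
        have := sub_mem h1 (hle hj)
        simpa using this
    · refine not_DG_of_rad _ _ v hv hv' ?_ hD
      rw [Ideal.ofList_cons] at hrad
      convert hrad using 2
      rw [sup_comm (Ideal.span _), sup_assoc]

theorem lemmaB (K : Type*) [Field K] [Infinite K] {A : Type*} [CommRing A] [IsLocalRing A]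
    [IsNoetherianRing A] [Algebra K A]
    : ∀ (fs : List A), (∀ g ∈ fs, g ∈ maximalIdeal A) →
    ∀ {M : Type*} [AddCommGroup M] [Module A M] [Module.Finite A M] (P : Ideal A),
    (∀ a ∈ P, ∀ u : M, a • u = 0) → maximalIdeal A ≤ (P ⊔ Ideal.ofList fs).radical →
    DG A M fs.length → IsWeaklyRegular M fs := by
  intro fs
  induction fs with
  | nil => intros; simp
  | cons f fs ih =>
    intro hfs M _ _ _ P hP hrad hD
    have hrad' : maximalIdeal A ≤ (P ⊔ Ideal.span {f} ⊔ Ideal.ofList fs).radical := by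
      rwa [sup_assoc, ← Ideal.ofList_cons]
    have hreg : IsSMulRegular M f := by
      rw [isSMulRegular_iff_right_eq_zero_of_smul]
      intro u hu
      by_contra hu0
      refine lemmaA K fs (fun g hg => hfs g (by simp [hg])) (P ⊔ Ideal.span {f}) u hu0 ?_
        hrad' hD
      have : P ⊔ Ideal.span {f} ≤ Module.annihilator A (Submodule.span A {u}) := by
        apply sup_le
        · intro a ha
          exact (Submodule.mem_annihilator_span_singleton _ _).2 (hP a ha u)
        · rw [Ideal.span_le]
          simp only [Set.singleton_subset_iff, SetLike.mem_coe]
          exact (Submodule.mem_annihilator_span_singleton _ _).2 hu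
      intro a ha
      exact (Submodule.mem_annihilator_span_singleton _ _).1 (this ha)
    rw [isWeaklyRegular_cons_iff]
    refine ⟨hreg, ih (fun g hg => hfs g (by simp [hg])) (P ⊔ Ideal.span {f}) ?_ hrad'
      (rees K _ f (hfs f (by simp)) hreg hD)⟩
    have : P ⊔ Ideal.span {f} ≤ Module.annihilator A (QuotSMulTop f M) := by
      apply sup_le
      · intro a ha
        rw [Module.mem_annihilator]
        intro u
        obtain ⟨m, rfl⟩ := Submodule.Quotient.mk_surjective _ u
        rw [← Submodule.Quotient.mk_smul, hP a ha]
        rfl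
      · rw [Ideal.span_le]
        simp only [Set.singleton_subset_iff, SetLike.mem_coe]
        rw [Module.mem_annihilator]
        intro u
        obtain ⟨m, rfl⟩ := Submodule.Quotient.mk_surjective _ u
        rw [← Submodule.Quotient.mk_smul, Submodule.Quotient.mk_eq_zero]
        exact Submodule.smul_mem_pointwise_smul _ _ _ trivial
    intro a ha
    exact Module.mem_annihilator.1 (this ha)

end local_part
section graded_part
open RingTheory.Sequence

theorem span_take_eq {R : Type*} [CommRing R] (rs : List R) (i : ℕ) (hi : i < rs.length) :
    Ideal.span {y | ∃ (j : ℕ) (hj : j < i), y = rs[j]'(hj.trans hi)} =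
      Ideal.ofList (rs.take i) := by
  rw [Ideal.ofList]
  congr 1
  ext y
  simp only [Set.mem_ofPred_eq, List.mem_take_iff_getElem]
  constructor
  · rintro ⟨j, hj, rfl⟩
    exact ⟨j, by omega, rfl⟩
  · rintro ⟨j, hj, rfl⟩
    exact ⟨j, by omega, rfl⟩

theorem isRegSeq_iff {R : Type*} [CommRing R] (rs : List R) :
    IsRegSeq rs ↔ IsWeaklyRegular R rs := by
  rw [isWeaklyRegular_iff]
  refine forall_congr' fun i => forall_congr' fun hi => ?_
  rw [isSMulRegular_quotient_iff_mem_of_smul_mem]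
  rw [span_take_eq rs i hi]
  simp only [smul_eq_mul, Ideal.mul_top]

theorem isRegSeq_X (K : Type*) [Field K] (n : ℕ) :
    IsRegSeq (List.ofFn fun i : Fin n => (X i : MvPolynomial (Fin n) K)) := by
  intro i hi x hx
  have hi' : i < n := by simpa using hi
  have hset : {y : MvPolynomial (Fin n) K | ∃ (j : ℕ) (hj : j < i),
      y = (List.ofFn fun i : Fin n => (X i : MvPolynomial (Fin n) K))[j]'(hj.trans hi)} =
      Set.image X {k : Fin n | (k : ℕ) < i} := by
    ext y
    simp only [Set.mem_ofPred_eq, List.getElem_ofFn, Set.mem_image]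
    constructor
    · rintro ⟨j, hj, rfl⟩
      exact ⟨⟨j, by omega⟩, hj, rfl⟩
    · rintro ⟨k, hk, rfl⟩
      exact ⟨k, hk, rfl⟩
  rw [hset, mem_ideal_span_X_image] at hx ⊢
  intro m hm
  rw [List.getElem_ofFn] at hx
  obtain ⟨k, hk, hk0⟩ := hx (Finsupp.single ⟨i, hi'⟩ 1 + m) (by
    rw [mem_support_iff, coeff_X_mul]
    exact mem_support_iff.1 hm)
  refine ⟨k, hk, ?_⟩
  have hne : (⟨i, hi'⟩ : Fin n) ≠ k := by
    rintro rfl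
    simp at hk
  simpa [Finsupp.single_apply, hne] using hk0

theorem hc_mul_gt {σ K : Type*} [Field K] (s φ : MvPolynomial σ K) (d j : ℕ)
    (hφ : φ.IsHomogeneous j) (h : d < j) : homogeneousComponent d (s * φ) = 0 := by
  conv_lhs => rw [← sum_homogeneousComponent s]
  rw [Finset.sum_mul, map_sum]
  refine Finset.sum_eq_zero fun i _ => ?_
  rw [homogeneousComponent_of_mem ((homogeneousComponent_isHomogeneous i s).mul hφ),
    if_neg (by omega)]

theorem hc_mul_eq {σ K : Type*} [Field K] (s φ : MvPolynomial σ K) (d : ℕ)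
    (hφ : φ.IsHomogeneous d) : homogeneousComponent d (s * φ) = C (coeff 0 s) * φ := by
  conv_lhs => rw [← sum_homogeneousComponent s]
  rw [Finset.sum_mul, map_sum, Finset.sum_eq_single 0]
  · rw [homogeneousComponent_of_mem ((homogeneousComponent_isHomogeneous 0 s).mul hφ),
      if_pos (by omega), homogeneousComponent_zero]
  · intro i _ hi
    rw [homogeneousComponent_of_mem ((homogeneousComponent_isHomogeneous i s).mul hφ),
      if_neg (by omega)]
  · simp

attribute [local instance] MvPolynomial.gradedAlgebra

theorem mem_of_mul_mem {σ K : Type*} [Field K] (I : Ideal (MvPolynomial σ K))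
    (hI : I.IsHomogeneous (homogeneousSubmodule σ K)) (s x : MvPolynomial σ K)
    (hs : coeff 0 s ≠ 0) (h : s * x ∈ I) : x ∈ I := by
  rw [mem_iff_homogeneousComponent_mem hI]
  intro d
  induction d using Nat.strong_induction_on with
  | _ d ih =>
    by_cases hd : d ∈ Finset.range (x.totalDegree + 1)
    · have h1 := homogeneousComponent_mem_of_mem hI h d
      conv at h1 => 
        enter [2]
        rw [← sum_homogeneousComponent x]
      rw [Finset.mul_sum, map_sum, ← Finset.add_sum_erase _ _ hd,
        hc_mul_eq _ _ _ (homogeneousComponent_isHomogeneous d x)] at h1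
      have h2 : ∑ j ∈ (Finset.range (x.totalDegree + 1)).erase d,
          homogeneousComponent d (s * homogeneousComponent j x) ∈ I := by
        refine sum_mem fun j hj => ?_
        rcases lt_or_gt_of_ne (Finset.ne_of_mem_erase hj) with hlt | hgt
        · exact homogeneousComponent_mem_of_mem hI (I.mul_mem_left _ (ih j hlt)) d
        · rw [hc_mul_gt _ _ _ _ (homogeneousComponent_isHomogeneous j x) hgt]
          exact zero_mem _
      have h3 := (Ideal.add_mem_iff_left I h2).1 h1
      have h4 := I.mul_mem_left (C (coeff 0 s)⁻¹) h3
      rwa [← mul_assoc, ← C_mul, inv_mul_cancel₀ hs, C_1, one_mul] at h4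
    · rw [homogeneousComponent_eq_zero _ _ (by simpa using hd)]
      exact zero_mem _

theorem main_reg {K : Type*} [Field K] [IsAlgClosed K] {n : ℕ}
    (fs : List (MvPolynomial (Fin n) K)) (hl : fs.length = n)
    (hhom : ∀ f ∈ fs, ∃ d, f.IsHomogeneous d) (h0 : ∀ f ∈ fs, eval 0 f = 0)
    (hz : ∀ v : Fin n → K, (∀ f ∈ fs, eval v f = 0) → v = 0) : IsRegSeq fs := by
  have : Infinite K := IsAlgClosed.instInfinite
  let R := MvPolynomial (Fin n) K
  let m0 : Ideal R := RingHom.ker (eval (0 : Fin n → K) : MvPolynomial (Fin n) K →+* K)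
  let A := LocAt K (0 : Fin n → K)
  have hmax : Ideal.map (algebraMap R A) m0 = IsLocalRing.maximalIdeal A :=
    Localization.AtPrime.map_eq_maximalIdeal
  have hnoeth : IsNoetherianRing A :=
    IsLocalization.isNoetherianRing m0.primeCompl A inferInstance
  have hmem : ∀ r : R, eval 0 r = 0 → algebraMap R A r ∈ IsLocalRing.maximalIdeal A := by
    intro r hr
    rw [← hmax]
    exact Ideal.mem_map_of_mem _ hr
  have hD : DG A A (fs.map (algebraMap R A)).length := by
    refine ⟨(List.ofFn fun i : Fin n => (X i : R)).map (algebraMap R A), by simp [hl], ?_, ?_⟩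
    · intro r hr
      rw [List.mem_map] at hr
      obtain ⟨q, hq, rfl⟩ := hr
      rw [List.mem_ofFn] at hq
      obtain ⟨i, rfl⟩ := hq
      exact hmem _ (by simp)
    · exact IsWeaklyRegular.of_isLocalization A m0.primeCompl ((isRegSeq_iff _).1 (isRegSeq_X K n))
  have hrad0 : m0 ≤ (Ideal.ofList fs).radical := by
    rw [← vanishingIdeal_zeroLocus_eq_radical (K := K)]
    intro r hr
    rw [mem_vanishingIdeal_iff]
    intro v hv
    have hv0 : v = 0 := by
      apply hz
      intro f hf
      have := hv f (Ideal.subset_span hf)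
      simpa [aeval_eq_eval] using this
    subst hv0
    rw [aeval_eq_eval]
    exact hr
  have hW : IsWeaklyRegular A (fs.map (algebraMap R A)) := by
    refine lemmaB K _ ?_ ⊥ ?_ ?_ hD
    · intro g hg
      rw [List.mem_map] at hg
      obtain ⟨q, hq, rfl⟩ := hg
      exact hmem _ (h0 q hq)
    · intro a ha u
      rw [Ideal.mem_bot] at ha
      simp [ha]
    · rw [bot_sup_eq, ← hmax, ← Ideal.map_ofList]
      exact (Ideal.map_mono hrad0).trans (Ideal.map_radical_le _)
  rw [← isRegSeq_iff] at hW
  intro i hi x hx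
  rw [span_take_eq _ _ hi] at hx ⊢
  have h1 := hW i (by simpa using hi) (algebraMap R A x)
  rw [span_take_eq _ _ (by simpa using hi), ← List.map_take, ← Ideal.map_ofList, List.getElem_map, ← map_mul] at h1
  have h2 := h1 (Ideal.mem_map_of_mem _ hx)
  rw [IsLocalization.algebraMap_mem_map_algebraMap_iff m0.primeCompl] at h2
  obtain ⟨s, hs, hsx⟩ := h2
  refine mem_of_mul_mem _ ?_ s x ?_ hsx
  · apply Ideal.homogeneous_span
    intro f hf
    obtain ⟨d, hd⟩ := hhom f (List.mem_of_mem_take hf)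
    exact ⟨d, hd⟩
  · intro hc
    apply hs
    change eval 0 s = 0
    rw [← hc, ← constantCoeff_eq, ← eval_zero]

end graded_part
theorem eval_smul_hom {σ K : Type*} [Field K] (F : MvPolynomial σ K) (δ : ℕ)
    (hF : F.IsHomogeneous δ) (a : K) (v : σ → K) : eval (a • v) F = a ^ δ * eval v F := by
  rw [eval_eq, eval_eq, Finset.mul_sum]
  refine Finset.sum_congr rfl fun d hd => ?_
  have hdeg := hF (mem_support_iff.1 hd)
  have : d.degree = δ := by
    rw [← hdeg, Finsupp.degree_eq_weight_one]; rfl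
  simp only [Pi.smul_apply, smul_eq_mul, mul_pow, Finset.prod_mul_distrib,
    Finset.prod_pow_eq_pow_sum]
  rw [← this, Finsupp.degree]
  ring_nf
  rfl

/-- `(y, 0)`. -/
def extPt {K : Type*} [Field K] {n : ℕ} (y : Fin (n - 1) → K) : Fin n → K :=
  fun i => if h : (i : ℕ) < n - 1 then y ⟨i, h⟩ else 0

theorem eval_trunc {K : Type*} [Field K] {n : ℕ} (F : MvPolynomial (Fin n) K)
    (y : Fin (n - 1) → K) : eval y (truncAtLast F) = eval (extPt y) F := by
  induction F using MvPolynomial.induction_on with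
  | C a => simp [truncAtLast, algebraMap_eq]
  | add p q hp hq => simp only [truncAtLast, map_add] at *; rw [hp, hq]
  | mul_X p i hp =>
    simp only [truncAtLast, map_mul, aeval_X, eval_X] at *
    rw [hp]
    congr 1
    unfold extPt
    split <;> simp

theorem pderiv_trunc {K : Type*} [Field K] {n : ℕ} (F : MvPolynomial (Fin n) K)
    (i : Fin (n - 1)) : pderiv i (truncAtLast F) =
      truncAtLast (pderiv (Fin.castLE (Nat.sub_le n 1) i) F) := by
  induction F using MvPolynomial.induction_on with
  | C a => simp [truncAtLast, algebraMap_eq]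
  | add p q hp hq => simp only [truncAtLast, map_add] at *; rw [hp, hq]
  | mul_X p j hp =>
    simp only [truncAtLast, map_mul, aeval_X, Derivation.leibniz, smul_eq_mul, map_add] at *
    rw [hp]
    congr 2
    by_cases h : (j : ℕ) < n - 1
    · rw [dif_pos h, pderiv_X, pderiv_X]
      by_cases hij : i = ⟨j, h⟩
      · subst hij
        simp
      · have : Fin.castLE (Nat.sub_le n 1) i ≠ j := by
          intro h'
          have h2 : (i : ℕ) = (j : ℕ) := by
            rw [← h']
            rfl
          exact hij (Fin.ext h2)
        rw [Pi.single_eq_of_ne (Ne.symm hij), Pi.single_eq_of_ne (Ne.symm this)]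
        simp
    · have : Fin.castLE (Nat.sub_le n 1) i ≠ j := by
        intro h'; apply h; rw [← h']; exact i.2
      rw [dif_neg h, pderiv_X, Pi.single_eq_of_ne (Ne.symm this)]
      simp

theorem delta_ne_zero {K : Type*} [Field K] [Infinite K] {n : ℕ} (hn : 2 ≤ n)
    (F : MvPolynomial (Fin n) K) (δ : ℕ) (hF : F.IsHomogeneous δ)
    (hfin : (projZeros {g | ∃ i, g = pderiv i F}).Finite) : δ ≠ 0 := by
  rintro rfl
  rw [← totalDegree_zero_iff_isHomogeneous, totalDegree_eq_zero_iff_eq_C] at hF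
  let w : K → Fin n → K := fun t i => if (i : ℕ) = 0 then 1 else t
  have hw : ∀ t, w t ≠ 0 := by
    intro t h
    have := congrFun h ⟨0, by omega⟩
    simp [w] at this
  refine Set.infinite_of_injective_forall_mem (f := fun t => Projectivization.mk K (w t) (hw t))
    ?_ ?_ hfin
  · intro s t hst
    simp only [Projectivization.mk_eq_mk_iff'] at hst
    obtain ⟨a, ha⟩ := hst
    have h0 := congrFun ha ⟨0, by omega⟩
    have h1 := congrFun ha ⟨1, by omega⟩
    simp [w] at h0 h1
    rw [h0] at h1
    simpa using h1.symm
  · intro t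
    refine ⟨w t, hw t, rfl, ?_⟩
    rintro g ⟨i, rfl⟩
    rw [hF]; simp

/-- Lemma 5.1: if `p ∣ δ`, the partial derivatives of the degree-`δ` form `F` have only
finitely many common zeros in `ℙ^{n-1}`, and `F(x_1,…,x_{n-1},0) = 0` is a smooth
hypersurface in `ℙ^{n-2}`, then `∂F/∂x_1, …, ∂F/∂x_{n-1}` form a regular sequence in
`K[x_1,…,x_n]`. -/
theorem statement15 {K : Type*} [Field K] [IsAlgClosed K] (p : ℕ) [CharP K p]
    (hp : p.Prime) {n : ℕ} (hn : 2 ≤ n)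
    (F : MvPolynomial (Fin n) K) (δ : ℕ) (hF : F.IsHomogeneous δ) (hpδ : p ∣ δ)
    (hfin : (projZeros {g | ∃ i, g = pderiv i F}).Finite)
    (hsmooth : SmoothProj (truncAtLast F)) :
    IsRegSeq (List.ofFn fun i : Fin (n - 1) =>
      pderiv (Fin.castLE (Nat.sub_le n 1) i) F) := by
  have hinf : Infinite K := IsAlgClosed.instInfinite
  have hδ : δ ≠ 0 := delta_ne_zero hn F δ hF hfin
  have hδ2 : 2 ≤ δ := hp.two_le.trans (Nat.le_of_dvd (Nat.pos_of_ne_zero hδ) hpδ)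
  let L : Fin n := ⟨n - 1, by omega⟩
  obtain ⟨c, hc⟩ := (hfin.image fun x => - eval x.rep F / (x.rep L) ^ δ).exists_notMem
  let g : MvPolynomial (Fin n) K := F + C c * X L ^ δ
  have hg : g.IsHomogeneous δ := hF.add (isHomogeneous_C_mul_X_pow c L δ)
  have heval0 : ∀ (f : MvPolynomial (Fin n) K) (d : ℕ), f.IsHomogeneous d → d ≠ 0 →
      eval 0 f = 0 := by
    intro f d hf hd
    have := eval_smul_hom f d hf 0 0
    simpa [hd] using this
  have key : IsRegSeq ((List.ofFn fun i : Fin (n - 1) =>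
      pderiv (Fin.castLE (Nat.sub_le n 1) i) F) ++ [g]) := by
    apply main_reg
    · simp; omega
    · intro f hf
      rw [List.mem_append, List.mem_ofFn, List.mem_singleton] at hf
      rcases hf with ⟨i, rfl⟩ | rfl
      · exact ⟨_, hF.pderiv⟩
      · exact ⟨_, hg⟩
    · intro f hf
      rw [List.mem_append, List.mem_ofFn, List.mem_singleton] at hf
      rcases hf with ⟨i, rfl⟩ | rfl
      · exact heval0 _ _ hF.pderiv (by omega)
      · exact heval0 _ _ hg hδ
    · intro v hv
      by_contra hv0
      have hvi : ∀ i : Fin (n - 1), eval v (pderiv (Fin.castLE (Nat.sub_le n 1) i) F) = 0 := by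
        intro i
        apply hv
        rw [List.mem_append, List.mem_ofFn]
        exact Or.inl ⟨i, rfl⟩
      have hvi' : ∀ i : Fin n, i ≠ L → eval v (pderiv i F) = 0 := by
        intro i hi
        have hlt : (i : ℕ) < n - 1 := by
          have h1 := i.2
          have h2 : (i : ℕ) ≠ n - 1 := fun h => hi (Fin.ext h)
          omega
        exact hvi ⟨i, hlt⟩
      have hgv : eval v F + c * v L ^ δ = 0 := by
        have := hv g (by simp)
        simpa [g] using this
      by_cases hL : v L = 0
      · let y : Fin (n - 1) → K := fun i => v (Fin.castLE (Nat.sub_le n 1) i)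
        have hy : extPt y = v := by
          funext i
          unfold extPt
          split
          · rfl
          · rename_i h
            have : i = L := Fin.ext (by have := i.2; simp only [L]; omega)
            rw [this, hL]
        refine hsmooth y ?_ ⟨?_, ?_⟩
        · intro h
          apply hv0
          rw [← hy, h]
          funext i
          simp [extPt]
        · rw [eval_trunc, hy]
          simpa [hL, hδ] using hgv
        · intro i
          rw [pderiv_trunc, eval_trunc, hy]
          exact hvi i
      · have hE := congrArg (eval v) hF.sum_X_mul_pderiv
        have hδ0 : (δ : K) = 0 := (CharP.cast_eq_zero_iff K p δ).2 hpδ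
        rw [map_sum, Finset.sum_eq_single L] at hE
        · have hLv : eval v (pderiv L F) = 0 := by
            have : v L * eval v (pderiv L F) = 0 := by
              simpa [hδ0] using hE
            exact (mul_eq_zero.1 this).resolve_left hL
          apply hc
          refine ⟨Projectivization.mk K v hv0, ⟨v, hv0, rfl, ?_⟩, ?_⟩
          · rintro _ ⟨i, rfl⟩
            by_cases hi : i = L
            · rw [hi, hLv]
            · exact hvi' i hi
          · obtain ⟨a, ha⟩ := Projectivization.exists_smul_eq_mk_rep K v hv0
            simp only
            rw [← ha]
            have ha0 : (a : K) ≠ 0 := a.ne_zero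
            have h1 : a • v = (a : K) • v := rfl
            rw [h1, eval_smul_hom F δ hF, Pi.smul_apply, smul_eq_mul, mul_pow]
            have h2 : (a : K) ^ δ ≠ 0 := pow_ne_zero _ ha0
            have h3 : v L ^ δ ≠ 0 := pow_ne_zero _ hL
            rw [div_eq_iff (mul_ne_zero h2 h3)]
            linear_combination -(a : K) ^ δ * hgv
        · intro i _ hi
          simp [hvi' i hi]
        · simp
  rw [isRegSeq_iff] at key ⊢
  exact ((RingTheory.Sequence.isWeaklyRegular_append_iff _ _ _).1 key).1

end
end

section
/- Let F ∈ K[x_1,…,x_n] be homogeneous of degree δ with p = char K dividing δ. Suppose the set of common zeros of ∂F/∂x_1,…,∂F/∂x_n in P^{n−1} is finite and that F(x_1,…,x_{n−1},0) = 0 defines a smooth hypersurface in P^{n−2}. If homogeneous polynomials ω_1,…,ω_n ∈ K[x_1,…,x_n] satisfy Σ_{i=1}^n (∂F/∂x_i) ω_i = 0, then for every i = 1,…,n the polynomial x_n ω_i − x_i ω_n lies in the ideal (∂F/∂x_1,…,∂F/∂x_{n−1}) of K[x_1,…,x_n]. -/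
open MvPolynomial

noncomputable section

def Nzd {R : Type*} [CommRing R] (Q : Ideal R) (x : R) : Prop := ∀ a, x * a ∈ Q → a ∈ Q

def DepthGe {R : Type*} [CommRing R] (I : Ideal R) : ℕ → Ideal R → Prop
  | 0, _ => True
  | r + 1, Q => ∃ x ∈ I, Nzd Q x ∧ DepthGe I r (Q ⊔ Ideal.span {x})

def NoSoc {R : Type*} [CommRing R] (I Q : Ideal R) : Prop :=
  ∀ a, (∀ i ∈ I, i * a ∈ Q) → a ∈ Q

section
variable {R : Type*} [CommRing R]

lemma mem_adj {Q : Ideal R} {x a : R} :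
    a ∈ Q ⊔ Ideal.span {x} ↔ ∃ c, a - x * c ∈ Q := by
  rw [Submodule.mem_sup]
  constructor
  · rintro ⟨q, hq, y, hy, rfl⟩
    obtain ⟨c, rfl⟩ := Ideal.mem_span_singleton'.1 hy
    refine ⟨c, ?_⟩
    have : q + c * x - x * c = q := by ring
    rwa [this]
  · rintro ⟨c, hc⟩
    exact ⟨_, hc, x * c, Ideal.mul_mem_right _ _ (Ideal.mem_span_singleton_self x), by ring⟩

lemma DepthGe.noSoc {I Q : Ideal R} {r : ℕ} (h : DepthGe I (r + 1) Q) : NoSoc I Q := by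
  obtain ⟨x, hx, hn, -⟩ := h
  exact fun a ha => hn a (ha x hx)

lemma nzd_swap {Q : Ideal R} {y z : R} (hy : Nzd Q y) (hz : Nzd (Q ⊔ Ideal.span {y}) z) :
    Nzd (Q ⊔ Ideal.span {z}) y := by
  intro m hm
  obtain ⟨m1, h1⟩ := mem_adj.1 hm
  have h2 : m1 ∈ Q ⊔ Ideal.span {y} := hz _ (mem_adj.2 ⟨m, by
    have := Q.neg_mem h1
    rwa [neg_sub] at this⟩)
  obtain ⟨m2, h3⟩ := mem_adj.1 h2
  refine mem_adj.2 ⟨m2, hy _ ?_⟩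
  have := Q.add_mem h1 (Q.mul_mem_left z h3)
  convert this using 1; ring

lemma noSoc_exchange {I Q : Ideal R} {x y : R} (hy : y ∈ I)
    (hxn : Nzd Q x) (hyn : Nzd Q y)
    (h : NoSoc I (Q ⊔ Ideal.span {y})) : NoSoc I (Q ⊔ Ideal.span {x}) := by
  intro a ha
  obtain ⟨b, hb⟩ := mem_adj.1 (ha y hy)
  have hb2 : b ∈ Q ⊔ Ideal.span {y} := by
    refine h b fun i hi => ?_
    obtain ⟨c, hc⟩ := mem_adj.1 (ha i hi)
    refine mem_adj.2 ⟨c, hxn _ ?_⟩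
    have := Q.sub_mem (Q.mul_mem_left y hc) (Q.mul_mem_left i hb)
    convert this using 1; ring
  obtain ⟨e, he⟩ := mem_adj.1 hb2
  refine mem_adj.2 ⟨e, hyn _ ?_⟩
  have := Q.add_mem hb (Q.mul_mem_left x he)
  convert this using 1; ring

lemma DepthGe.congr {I I' Q : Ideal R} {r : ℕ} (hI : I ≤ I' ⊔ Q) (h : DepthGe I r Q) :
    DepthGe I' r Q := by
  induction r generalizing Q with
  | zero => trivial
  | succ r ih =>
    obtain ⟨x, hx, hn, hd⟩ := h
    obtain ⟨x', hx', q, hq, rfl⟩ := Submodule.mem_sup.1 (hI hx)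
    have e : Q ⊔ Ideal.span {x' + q} = Q ⊔ Ideal.span {x'} := by
      ext a
      rw [mem_adj, mem_adj]
      refine exists_congr fun c => ?_
      have : a - x' * c = (a - (x' + q) * c) + q * c := by ring
      rw [this, Ideal.add_mem_iff_left _ (Q.mul_mem_right c hq)]
    refine ⟨x', hx', fun a ha => hn a ?_, ?_⟩
    · rw [add_mul]; exact Q.add_mem ha (Q.mul_mem_right _ hq)
    · rw [← e]
      exact ih (hI.trans (sup_le_sup_left le_sup_left _)) hd

variable {K : Type*} [Field K] [Algebra K R]

def zt {n : ℕ} (f : Fin n → R) (t : K) : R := ∑ j : Fin n, algebraMap K R t ^ (j : ℕ) * f j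

lemma zt_mem {n : ℕ} (f : Fin n → R) (t : K) : zt f t ∈ Ideal.span (Set.range f) :=
  Ideal.sum_mem _ fun j _ => Ideal.mul_mem_left _ _ (Ideal.subset_span ⟨j, rfl⟩)

lemma prime_finite {n : ℕ} (f : Fin n → R) (P : Ideal R) [P.IsPrime]
    (hP : ¬ Ideal.span (Set.range f) ≤ P) : {t : K | zt f t ∈ P}.Finite := by
  by_contra hinf
  apply hP
  let q : Polynomial (R ⧸ P) :=
    ∑ j : Fin n, Polynomial.C (Ideal.Quotient.mk P (f j)) * Polynomial.X ^ (j : ℕ)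
  have hq : q = 0 := by
    apply Polynomial.eq_zero_of_infinite_isRoot
    have hinj : Function.Injective (algebraMap K (R ⧸ P)) := (algebraMap K (R ⧸ P)).injective
    refine Set.Infinite.mono ?_ (Set.Infinite.image hinj.injOn hinf)
    rintro _ ⟨t, ht, rfl⟩
    have h0 : Ideal.Quotient.mk P (zt f t) = 0 := Ideal.Quotient.eq_zero_iff_mem.2 ht
    rw [zt, map_sum] at h0
    change Polynomial.eval _ q = 0
    rw [← h0, Polynomial.eval_finsetSum]
    refine Finset.sum_congr rfl fun j _ => ?_
    simp only [Polynomial.eval_mul, Polynomial.eval_C, Polynomial.eval_pow, Polynomial.eval_X,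
      map_mul, map_pow]
    rw [mul_comm]; rfl
  rw [Ideal.span_le]
  rintro _ ⟨j, rfl⟩
  apply Ideal.Quotient.eq_zero_iff_mem.1
  have := congrArg (fun s => Polynomial.coeff s (j : ℕ)) hq
  simpa [q, Polynomial.finsetSum_coeff, Polynomial.coeff_X_pow, Fin.val_inj] using this

lemma generic_finite [IsNoetherianRing R] {n : ℕ} (f : Fin n → R) (Q : Ideal R)
    (h : NoSoc (Ideal.span (Set.range f)) Q) : {t : K | ¬ Nzd Q (zt f t)}.Finite := by
  have hfin := associatedPrimes.finite R (R ⧸ Q)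
  refine Set.Finite.subset (Set.Finite.biUnion hfin
    (t := fun P => {t : K | P.IsPrime ∧ ¬ Ideal.span (Set.range f) ≤ P ∧ zt f t ∈ P}) ?_) ?_
  · intro P hP
    by_cases hc : P.IsPrime ∧ ¬ Ideal.span (Set.range f) ≤ P
    · have := hc.1
      exact (prime_finite (K := K) f P hc.2).subset fun t ht => ht.2.2
    · convert Set.finite_empty
      ext t; simp only [Set.mem_ofPred_eq, Set.mem_empty_iff_false, iff_false]; tauto
  · intro t ht
    simp only [Set.mem_ofPred_eq, Nzd, not_forall] at ht
    obtain ⟨a, ha, haQ⟩ := ht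
    have hz : zt f t ∈ ⋃ p ∈ associatedPrimes R (R ⧸ Q), (p : Set R) := by
      rw [biUnion_associatedPrimes_eq_zero_divisors]
      refine ⟨Ideal.Quotient.mk Q a, ?_, ?_⟩
      · rwa [Ne, Ideal.Quotient.eq_zero_iff_mem]
      · rw [Algebra.smul_def]
        change Ideal.Quotient.mk Q _ * _ = 0
        rwa [← map_mul, Ideal.Quotient.eq_zero_iff_mem]
    simp only [Set.mem_iUnion] at hz ⊢
    obtain ⟨P, hP, hzP⟩ := hz
    refine ⟨P, hP, hP.isPrime, fun hle => ?_, hzP⟩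
    have hPa : IsAssociatedPrime P (R ⧸ Q) := hP
    rw [isAssociatedPrime_iff] at hPa
    obtain ⟨hpr, b, rfl⟩ := hPa
    obtain ⟨b, rfl⟩ := Ideal.Quotient.mk_surjective b
    have hmem : ∀ i, i ∈ (⊥ : Submodule R (R ⧸ Q)).colon {Ideal.Quotient.mk Q b} ↔ i * b ∈ Q := by
      intro i
      rw [Submodule.mem_colon_singleton, Submodule.mem_bot, Algebra.smul_def]
      change Ideal.Quotient.mk Q _ * _ = 0 ↔ _
      rw [← map_mul, Ideal.Quotient.eq_zero_iff_mem]
    have hb : b ∈ Q := h b fun i hi => (hmem i).1 (hle hi)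
    exact hpr.ne_top ((Ideal.eq_top_iff_one _).2 ((hmem 1).2 (by simpa using hb)))

lemma DepthGe.drop [Infinite K] [IsNoetherianRing R] {n : ℕ} (f : Fin n → R) {r : ℕ} {Q : Ideal R}
    {x : R} (hx : x ∈ Ideal.span (Set.range f)) (hn : Nzd Q x)
    (h : DepthGe (Ideal.span (Set.range f)) (r + 1) Q) :
    DepthGe (Ideal.span (Set.range f)) r (Q ⊔ Ideal.span {x}) := by
  induction r generalizing Q x with
  | zero => trivial
  | succ r ih =>
    obtain ⟨y, hy, hyn, hd⟩ := h
    have hNy := hd.noSoc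
    have hNx := noSoc_exchange hy hn hyn hNy
    obtain ⟨t, ht⟩ := ((generic_finite (K := K) f _ hNy).union
      (generic_finite (K := K) f _ hNx)).exists_notMem
    simp only [Set.mem_union, Set.mem_ofPred_eq, not_or, not_not] at ht
    have hz := zt_mem f t
    generalize zt f t = z at ht hz
    have h1 := ih hz ht.1 hd
    rw [sup_right_comm] at h1
    have h2 : DepthGe (Ideal.span (Set.range f)) (r + 1) (Q ⊔ Ideal.span {z}) :=
      ⟨y, hy, nzd_swap hyn ht.1, h1⟩
    have h3 := ih hx (nzd_swap hn ht.2) h2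
    rw [sup_right_comm] at h3
    exact ⟨z, hz, ht.2, h3⟩

theorem syz_mem [Infinite K] [IsNoetherianRing R] {n : ℕ} (f : Fin n → R) (Q : Ideal R)
    (h : DepthGe (Ideal.span (Set.range f)) n Q) (m : Fin n → R)
    (hm : ∑ i, f i * m i ∈ Q) (i : Fin n) : m i ∈ Ideal.span (Set.range f) ⊔ Q := by
  induction n generalizing Q with
  | zero => exact i.elim0
  | succ n ih =>
    have hfin := generic_finite (K := K) f Q h.noSoc
    have key : ∀ t : K, Nzd Q (zt f t) → ∀ j : Fin n,
        m j.succ - algebraMap K R t ^ ((j : ℕ) + 1) * m 0 ∈ Ideal.span (Set.range f) ⊔ Q := by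
      intro t ht j
      have hd := DepthGe.drop (K := K) f (zt_mem f t) ht h
      have hz : zt f t = f 0 + ∑ j : Fin n, algebraMap K R t ^ ((j : ℕ) + 1) * f j.succ := by
        simp [zt, Fin.sum_univ_succ]
      have hd' : DepthGe (Ideal.span (Set.range fun j : Fin n => f j.succ)) n
          (Q ⊔ Ideal.span {zt f t}) := by
        refine hd.congr ?_
        rw [Ideal.span_le]
        rintro _ ⟨i, rfl⟩
        refine Fin.cases ?_ (fun i => ?_) i
        · have : f 0 = - (∑ j : Fin n, algebraMap K R t ^ ((j : ℕ) + 1) * f j.succ) + zt f t := by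
            rw [hz]; ring
          rw [this]
          refine Ideal.add_mem _ (Ideal.mem_sup_left (neg_mem (Ideal.sum_mem _ fun j _ =>
            Ideal.mul_mem_left _ _ (Ideal.subset_span ⟨j, rfl⟩)))) ?_
          exact Ideal.mem_sup_right (Ideal.mem_sup_right (Ideal.mem_span_singleton_self _))
        · exact Ideal.mem_sup_left (Ideal.subset_span ⟨i, rfl⟩)
      have := ih (fun j => f j.succ) _ hd'
        (fun j => m j.succ - algebraMap K R t ^ ((j : ℕ) + 1) * m 0) (by
          refine mem_adj.2 ⟨- m 0, ?_⟩
          convert hm using 1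
          rw [Fin.sum_univ_succ, hz]
          simp only [mul_sub, Finset.sum_sub_distrib]
          have : ∑ j : Fin n, f j.succ * (algebraMap K R t ^ ((j : ℕ) + 1) * m 0)
            = (∑ j : Fin n, algebraMap K R t ^ ((j : ℕ) + 1) * f j.succ) * m 0 := by
            rw [Finset.sum_mul]
            exact Finset.sum_congr rfl fun _ _ => by ring
          rw [this]; ring) j
      refine (sup_le ?_ (sup_le le_sup_right ?_) : _ ≤ Ideal.span (Set.range f) ⊔ Q) this
      · refine le_trans (Ideal.span_mono ?_) le_sup_left
        rintro _ ⟨j, rfl⟩; exact ⟨_, rfl⟩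
      · rw [Ideal.span_singleton_le_iff_mem]
        exact Ideal.mem_sup_left (zt_mem f t)
    obtain ⟨t, ht⟩ := hfin.exists_notMem
    simp only [Set.mem_ofPred_eq, not_not] at ht
    have h0 : m 0 ∈ Ideal.span (Set.range f) ⊔ Q := by
      rcases n with _ | n
      · refine Ideal.mem_sup_right (ht _ ?_)
        simpa [zt] using hm
      · obtain ⟨s, hs⟩ := (hfin.union (Set.finite_singleton t)).exists_notMem
        simp only [Set.mem_union, Set.mem_ofPred_eq, not_or, not_not, Set.mem_singleton_iff] at hs
        have := Ideal.mul_mem_left _ (algebraMap K R (s - t)⁻¹)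
          (Ideal.sub_mem _ (key t ht 0) (key s hs.1 0))
        convert this using 1
        have hst : algebraMap K R (s - t)⁻¹ * algebraMap K R (s - t) = 1 := by
          rw [← map_mul, inv_mul_cancel₀ (sub_ne_zero.2 hs.2), map_one]
        rw [map_sub] at hst
        simp only [Fin.val_zero, zero_add, pow_one]
        linear_combination (-m 0) * hst
    refine Fin.cases h0 (fun j => ?_) i
    have := Ideal.add_mem _ (key t ht j) (Ideal.mul_mem_left _ (algebraMap K R t ^ ((j : ℕ) + 1)) h0)
    rwa [sub_add_cancel] at this
end

lemma depth_X {K : Type*} [Field K] {n : ℕ} (I : Ideal (MvPolynomial (Fin n) K)) (N : ℕ)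
    (hN : ∀ i, (X i : MvPolynomial (Fin n) K) ^ N ∈ I) : DepthGe I n ⊥ := by
  let s : ℕ → Set (Fin n →₀ ℕ) := fun k => {s | ∃ j : Fin n, (j : ℕ) < k ∧ s = Finsupp.single j N}
  let Q : ℕ → Ideal (MvPolynomial (Fin n) K) := fun k =>
    Ideal.span ((fun s => monomial s (1 : K)) '' s k)
  have key : ∀ r k, k + r = n → DepthGe I r (Q k) := by
    intro r
    induction r with
    | zero => intro k _; trivial
    | succ r ih =>
      intro k hk
      have hkn : k < n := by omega
      have hX : (X ⟨k, hkn⟩ : MvPolynomial (Fin n) K) ^ N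
          = monomial (Finsupp.single ⟨k, hkn⟩ N) 1 := X_pow_eq_monomial
      refine ⟨X ⟨k, hkn⟩ ^ N, hN _, ?_, ?_⟩
      · intro a ha
        rw [mem_ideal_span_monomial_image] at ha ⊢
        intro e he
        obtain ⟨_, ⟨j, hj, rfl⟩, hle⟩ := ha (Finsupp.single ⟨k, hkn⟩ N + e) (by
          rw [mem_support_iff, hX, coeff_monomial_mul, one_mul]
          exact mem_support_iff.1 he)
        refine ⟨_, ⟨j, hj, rfl⟩, ?_⟩
        have hne : (⟨k, hkn⟩ : Fin n) ≠ j := by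
          rintro rfl; simp at hj
        rw [Finsupp.single_le_iff] at hle ⊢
        simpa [Finsupp.single_apply, hne] using hle
      · have e : Q k ⊔ Ideal.span {X ⟨k, hkn⟩ ^ N} = Q (k + 1) := by
          simp only [Q]
          rw [← Ideal.span_union, hX, ← Set.image_singleton (f := fun s => monomial s (1 : K)),
            ← Set.image_union]
          congr 2
          ext t
          simp only [s, Set.mem_union, Set.mem_ofPred_eq, Set.mem_singleton_iff]
          constructor
          · rintro (⟨j, hj, rfl⟩ | rfl)
            · exact ⟨j, by omega, rfl⟩
            · exact ⟨⟨k, hkn⟩, by simp, rfl⟩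
          · rintro ⟨j, hj, rfl⟩
            rcases Nat.lt_succ_iff_lt_or_eq.1 hj with h | h
            · exact Or.inl ⟨j, h, rfl⟩
            · right; congr 1; exact Fin.ext h
        rw [e]
        exact ih (k + 1) (by omega)
  have h0 : Q 0 = ⊥ := by simp [Q, s]
  rw [← h0]
  exact key n 0 (by omega)

lemma mem_of_forall_pow {K : Type*} [Field K] {σ : Type*} (S : Set (MvPolynomial σ K))
    (hS : ∀ y ∈ S, ∃ d, y.IsHomogeneous d) (g : MvPolynomial σ K) (δ : ℕ) (hδ : 0 < δ)
    (hg : g.IsHomogeneous δ) (a : MvPolynomial σ K)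
    (h : ∀ k, a ∈ Ideal.span S ⊔ Ideal.span {g ^ k}) : a ∈ Ideal.span S := by
  letI : GradedAlgebra (homogeneousSubmodule σ K) := MvPolynomial.gradedAlgebra
  have hJ : (Ideal.span S).IsHomogeneous (homogeneousSubmodule σ K) :=
    Ideal.homogeneous_span _ _ fun y hy => hS y hy
  obtain ⟨b, hb, c, hc, rfl⟩ := Submodule.mem_sup.1 (h (a.totalDegree + 1))
  set k := (b + c).totalDegree + 1 with hk
  have hG : (Ideal.span {g ^ k}).IsHomogeneous (homogeneousSubmodule σ K) := by
    refine Ideal.homogeneous_span _ _ fun y hy => ?_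
    rw [Set.mem_singleton_iff.1 hy]
    exact ⟨_, hg.pow k⟩
  rw [← sum_homogeneousComponent (b + c)]
  refine Ideal.sum_mem _ fun d hd => ?_
  rw [map_add]
  have h1 : homogeneousComponent d c = 0 := by
    by_contra hne
    obtain ⟨e, he⟩ := Ideal.mem_span_singleton.1 (homogeneousComponent_mem_of_mem hG hc d)
    have hhom := homogeneousComponent_isHomogeneous d c
    have ht := hhom.totalDegree hne
    rw [he] at ht hne
    rw [totalDegree_mul_of_isDomain (left_ne_zero_of_mul hne) (right_ne_zero_of_mul hne),
      (hg.pow k).totalDegree (left_ne_zero_of_mul hne)] at ht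
    have : k ≤ δ * k := Nat.le_mul_of_pos_left k hδ
    have := Finset.mem_range.1 hd
    omega
  rw [h1, add_zero]
  exact homogeneousComponent_mem_of_mem hJ hb d

lemma hom_eval_smul {K : Type*} [Field K] {n : ℕ} {q : MvPolynomial (Fin n) K} {d : ℕ}
    (hq : q.IsHomogeneous d) (s : K) (v : Fin n → K) :
    eval (s • v) q = s ^ d * eval v q := by
  rw [eval_eq', eval_eq', Finset.mul_sum]
  refine Finset.sum_congr rfl fun e he => ?_
  have h1 : e.degree = d := by
    have := hq (mem_support_iff.1 he)
    rwa [Finsupp.degree_eq_weight_one]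
  rw [← h1, Finsupp.degree_eq_sum, ← Finset.prod_pow_eq_pow_sum]
  simp only [Pi.smul_apply, smul_eq_mul, mul_pow, Finset.prod_mul_distrib]
  ring

lemma eval_truncAtLast {K : Type*} [Field K] {m : ℕ} (F : MvPolynomial (Fin (m + 1)) K)
    (v : Fin (m + 1) → K) (hv : v (Fin.last m) = 0) :
    eval (fun j : Fin m => v j.castSucc) (truncAtLast F) = eval v F := by
  rw [truncAtLast]
  induction F using MvPolynomial.induction_on with
  | C a => rw [aeval_C, eval_C]; exact eval_C _
  | add q r hq hr => rw [map_add, map_add, map_add, hq, hr]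
  | mul_X q i hq =>
    rw [map_mul, map_mul, map_mul, hq, aeval_X, eval_X]
    congr 1
    refine Fin.lastCases ?_ (fun j => ?_) i
    · simp [hv]
    · have : (j.castSucc : ℕ) < m + 1 - 1 := by simp
      rw [dif_pos this, eval_X]; rfl

lemma pderiv_truncAtLast {K : Type*} [Field K] {m : ℕ} (F : MvPolynomial (Fin (m + 1)) K)
    (i : Fin m) :
    pderiv i (truncAtLast F : MvPolynomial (Fin m) K) = truncAtLast (pderiv i.castSucc F) := by
  simp only [truncAtLast]
  induction F using MvPolynomial.induction_on with
  | C a =>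
    rw [aeval_C, pderiv_C, map_zero]; exact pderiv_C
  | add q r hq hr => rw [map_add, map_add, map_add, map_add, hq, hr]
  | mul_X q k hq =>
    rw [map_mul, Derivation.leibniz, Derivation.leibniz, hq, aeval_X, smul_eq_mul, smul_eq_mul,
      smul_eq_mul, smul_eq_mul, map_add, map_mul, map_mul, aeval_X]
    congr 2
    refine Fin.lastCases ?_ (fun j => ?_) k
    · rw [pderiv_X_of_ne (Fin.castSucc_lt_last i).ne']
      simp
    · have : (j.castSucc : ℕ) < m + 1 - 1 := by simp
      rw [dif_pos this]
      change pderiv i (X j) = _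
      rw [pderiv_X, pderiv_X]
      by_cases h : j = i
      · subst h; simp
      · have h' : j.castSucc ≠ i.castSucc := fun h' => h (Fin.castSucc_injective _ h')
        rw [Pi.single_eq_of_ne h, Pi.single_eq_of_ne h', map_zero]

theorem main_succ {K : Type*} [Field K] [IsAlgClosed K] (p : ℕ) [CharP K p]
    {m : ℕ} (hm : 1 ≤ m)
    (F : MvPolynomial (Fin (m + 1)) K) (δ : ℕ) (hF : F.IsHomogeneous δ) (hpδ : p ∣ δ)
    (hfin : (projZeros {g | ∃ i, g = pderiv i F}).Finite)
    (hsmooth : SmoothProj (truncAtLast F : MvPolynomial (Fin m) K))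
    (ω : Fin (m + 1) → MvPolynomial (Fin (m + 1)) K)
    (hrel : ∑ i, pderiv i F * ω i = 0) (i : Fin (m + 1)) :
      X (Fin.last m) * ω i - X i * ω (Fin.last m) ∈
        Ideal.span (Set.range fun j : Fin m => pderiv j.castSucc F) := by
  classical
  have hK : Infinite K := IsAlgClosed.instInfinite
  have hE : ∑ i, X i * pderiv i F = 0 := by
    rw [hF.sum_X_mul_pderiv, nsmul_eq_mul]
    have : (δ : MvPolynomial (Fin (m + 1)) K) = C (δ : K) := by simp
    rw [this, (CharP.cast_eq_zero_iff K p δ).2 hpδ, C_0, zero_mul]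
  -- the finite set of critical points in the chart where the last coordinate is one
  have hS : {v : Fin (m + 1) → K | v (Fin.last m) = 1 ∧
      ∀ i, eval v (pderiv i F) = 0}.Finite := by
    have hne : ∀ v : Fin (m + 1) → K, v (Fin.last m) = 1 → v ≠ 0 := by
      rintro v hv rfl; simp at hv
    refine Set.Finite.of_finite_image (f := fun v => if h : v ≠ 0 then
      Projectivization.mk K v h else Projectivization.mk K (fun _ => 1)
        (fun h => one_ne_zero (congrFun h 0))) (hfin.subset ?_) ?_
    · rintro _ ⟨v, ⟨hv, hz⟩, rfl⟩
      refine ⟨v, hne v hv, ?_, ?_⟩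
      · exact (dif_pos (hne v hv)).symm
      · rintro _ ⟨i, rfl⟩; exact hz i
    · rintro v ⟨hv, -⟩ w ⟨hw, -⟩ h
      simp only [] at h
      rw [dif_pos (hne v hv), dif_pos (hne w hw), Projectivization.mk_eq_mk_iff'] at h
      obtain ⟨a, rfl⟩ := h
      rw [Pi.smul_apply, hw, smul_eq_mul, mul_one] at hv
      rw [hv, one_smul]
  have hδ : 0 < δ := by
    rcases Nat.eq_zero_or_pos δ with rfl | h
    · exfalso
      rw [← totalDegree_zero_iff_isHomogeneous, totalDegree_eq_zero_iff_eq_C] at hF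
      have hinj : Function.Injective
          (fun t : K => (Fin.snoc (fun _ : Fin m => t) 1 : Fin (m + 1) → K)) := by
        intro t s h
        have := congrFun h (Fin.castSucc ⟨0, hm⟩)
        simp only [Fin.snoc_castSucc] at this
        exact this
      refine Set.infinite_range_of_injective hinj (hS.subset ?_)
      rintro _ ⟨t, rfl⟩
      refine ⟨by simp, fun i => ?_⟩
      rw [hF, pderiv_C, map_zero]
    · exact h
  obtain ⟨c, hc⟩ := (hS.image fun v => - eval v F).exists_notMem
  set g : MvPolynomial (Fin (m + 1)) K := F + C c * X (Fin.last m) ^ δ with hgdef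
  have hg : g.IsHomogeneous δ := by
    refine hF.add ?_
    have := (isHomogeneous_C (Fin (m + 1)) c).mul (isHomogeneous_X_pow (R := K) (Fin.last m) δ)
    rwa [zero_add] at this
  have hzero : ∀ v : Fin (m + 1) → K, (∀ j : Fin m, eval v (pderiv j.castSucc F) = 0) →
      eval v g = 0 → v = 0 := by
    intro v hv hgv
    by_cases hl : v (Fin.last m) = 0
    · by_contra hne
      refine hsmooth (fun j => v j.castSucc) ?_ ⟨?_, fun j => ?_⟩
      · intro h
        apply hne
        funext i
        exact Fin.lastCases hl (fun j => congrFun h j) i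
      · refine (eval_truncAtLast F v hl).trans ?_
        simpa [hgdef, hl, hδ.ne'] using hgv
      · refine (congrArg _ (pderiv_truncAtLast F j)).trans ?_
        exact (eval_truncAtLast _ v hl).trans (hv j)
    · exfalso
      set s := (v (Fin.last m))⁻¹ with hs
      apply hc
      have hw1 : (s • v) (Fin.last m) = 1 := by simp [hs, hl]
      have hw : ∀ j : Fin m, eval (s • v) (pderiv j.castSucc F) = 0 := fun j => by
        rw [hom_eval_smul hF.pderiv, hv j, mul_zero]
      refine ⟨s • v, ⟨hw1, ?_⟩, ?_⟩
      · intro i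
        refine Fin.lastCases ?_ hw i
        have := congrArg (eval (s • v)) hE
        rw [Fin.sum_univ_castSucc] at this
        simpa only [map_add, map_sum, map_mul, hw, mul_zero, Finset.sum_const_zero, zero_add,
          eval_X, hw1, one_mul, map_zero] using this
      · have h0 : eval (s • v) g = 0 := by rw [hom_eval_smul hg, hgv, mul_zero]
        rw [hgdef, map_add, map_mul, map_pow, eval_C, eval_X, hw1, one_pow, mul_one] at h0
        linear_combination -h0
  -- the relation among the first `m` partial derivatives
  have hrel2 : ∑ j : Fin m, pderiv j.castSucc F *
      (X (Fin.last m) * ω j.castSucc - X j.castSucc * ω (Fin.last m)) = 0 := by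
    rw [Fin.sum_univ_castSucc] at hrel hE
    simp only [mul_sub, Finset.sum_sub_distrib]
    have e1 : ∑ j : Fin m, pderiv j.castSucc F * (X (Fin.last m) * ω j.castSucc)
        = X (Fin.last m) * ∑ j : Fin m, pderiv j.castSucc F * ω j.castSucc := by
      rw [Finset.mul_sum]; exact Finset.sum_congr rfl fun _ _ => by ring
    have e2 : ∑ j : Fin m, pderiv j.castSucc F * (X j.castSucc * ω (Fin.last m))
        = ω (Fin.last m) * ∑ j : Fin m, X j.castSucc * pderiv j.castSucc F := by
      rw [Finset.mul_sum]; exact Finset.sum_congr rfl fun _ _ => by ring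
    rw [e1, e2]
    linear_combination X (Fin.last m) * hrel - ω (Fin.last m) * hE
  refine Fin.lastCases ?_ (fun j => ?_) i
  · rw [sub_self]; exact Ideal.zero_mem _
  refine mem_of_forall_pow _ ?_ g δ hδ hg _ fun k => ?_
  · rintro _ ⟨j, rfl⟩; exact ⟨_, hF.pderiv⟩
  let f : Fin (m + 1) → MvPolynomial (Fin (m + 1)) K :=
    Fin.snoc (fun j : Fin m => pderiv j.castSucc F) (g ^ k)
  have hfc : ∀ j : Fin m, f j.castSucc = pderiv j.castSucc F := fun j => by simp [f]
  have hfl : f (Fin.last m) = g ^ k := by simp [f]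
  have hN : ∃ N, ∀ i, (X i : MvPolynomial (Fin (m + 1)) K) ^ N ∈ Ideal.span (Set.range f) := by
    have hrad : ∀ i, (X i : MvPolynomial (Fin (m + 1)) K) ∈ (Ideal.span (Set.range f)).radical := by
      intro i
      rw [← vanishingIdeal_zeroLocus_eq_radical (K := K), mem_vanishingIdeal_iff]
      intro v hv
      rw [mem_zeroLocus_iff] at hv
      have hv' : ∀ i, eval v (f i) = 0 := fun i => hv _ (Ideal.subset_span ⟨i, rfl⟩)
      have hvg := hv' (Fin.last m)
      rw [hfl, map_pow] at hvg
      have : v = 0 := hzero v (fun j => by rw [← hfc]; exact hv' _)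
        (eq_zero_of_pow_eq_zero hvg)
      simp [this]
    choose N hN using hrad
    refine ⟨∑ i, N i, fun i => Ideal.pow_mem_of_pow_mem _ (hN i)
      (Finset.single_le_sum (fun _ _ => Nat.zero_le _) (Finset.mem_univ i))⟩
  obtain ⟨N, hN⟩ := hN
  have hd := depth_X _ N hN
  have := syz_mem (K := K) f ⊥ hd
    (Fin.snoc (fun j : Fin m => X (Fin.last m) * ω j.castSucc - X j.castSucc * ω (Fin.last m)) 0)
    (by
      rw [Fin.sum_univ_castSucc]
      simp only [Fin.snoc_castSucc, Fin.snoc_last, mul_zero, add_zero, hfc]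
      rw [hrel2]; exact Ideal.zero_mem _) j.castSucc
  rw [Fin.snoc_castSucc, sup_bot_eq] at this
  refine (Ideal.span_le.2 ?_ : Ideal.span (Set.range f) ≤ _) this
  rintro _ ⟨i, rfl⟩
  refine Fin.lastCases ?_ (fun j => ?_) i
  · rw [hfl]; exact Ideal.mem_sup_right (Ideal.mem_span_singleton_self _)
  · rw [hfc]; exact Ideal.mem_sup_left (Ideal.subset_span ⟨j, rfl⟩)

/-- (5.12): under the hypotheses of Lemma 5.1, if homogeneous `ω_1, …, ω_n` satisfy
`∑ (∂F/∂x_i) ω_i = 0`, then for every `i` the polynomial `x_n ω_i - x_i ω_n` lies in the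
ideal `(∂F/∂x_1, …, ∂F/∂x_{n-1})`. -/
theorem statement16 {K : Type*} [Field K] [IsAlgClosed K] (p : ℕ) [CharP K p]
    (hp : p.Prime) {n : ℕ} (hn : 2 ≤ n)
    (F : MvPolynomial (Fin n) K) (δ : ℕ) (hF : F.IsHomogeneous δ) (hpδ : p ∣ δ)
    (hfin : (projZeros {g | ∃ i, g = pderiv i F}).Finite)
    (hsmooth : SmoothProj (truncAtLast F))
    (ω : Fin n → MvPolynomial (Fin n) K)
    (hω : ∀ i, ∃ d, (ω i).IsHomogeneous d)
    (hrel : ∑ i, pderiv i F * ω i = 0) :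
    ∀ i : Fin n,
      X (⟨n - 1, by omega⟩ : Fin n) * ω i - X i * ω ⟨n - 1, by omega⟩ ∈
        Ideal.span {y | ∃ j : Fin n, (j : ℕ) < n - 1 ∧ y = pderiv j F} := by
  obtain ⟨m, rfl⟩ : ∃ m, n = m + 1 := ⟨n - 1, by omega⟩
  intro i
  have h := main_succ p (by omega) F δ hF hpδ hfin hsmooth ω hrel i
  refine (Ideal.span_mono ?_ : Ideal.span _ ≤ _) h
  rintro _ ⟨j, rfl⟩
  exact ⟨j.castSucc, by simp, rfl⟩


end
end
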